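/- arXiv:1403.1973 — 3 statements merged into one kernel-verified Lean document; each statement's English description precedes it below -/
import Mathlib

section
/- For every semisimplicial set Y, the unit map ι_Y : Y → 𝔣(𝔡(Y)) of the adjunction 𝔡 ⊣ 𝔣 is a monomorphism of semisimplicial sets; i.e., in every degree n the map Y_n → 𝔡(Y)_n is injective, so Y embeds naturally into the underlying semisimplicial set of the free simplicial set 𝔡(Y). -/
open CategoryTheory Opposite

/-- The semisimplex category `Δ₊`: same objects as `SimplexCategory`, but only the
injective (i.e. strictly order-preserving) order-preserving maps. -/
def SemiSimplexCat : Type := SimplexCategory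

/-- Interpret an object of `Δ₊` as an object of the simplex category. -/
def SemiSimplexCat.toSimplex : SemiSimplexCat → SimplexCategory := id

/-- The object `[n]` of `Δ₊`. -/
def SemiSimplexCat.mk (n : ℕ) : SemiSimplexCat := SimplexCategory.mk n

instance : Category SemiSimplexCat where
  Hom a b := { f : a.toSimplex ⟶ b.toSimplex // Function.Injective f.toOrderHom }
  id a := ⟨𝟙 _, fun x y h => by simpa using h⟩
  comp f g := ⟨f.1 ≫ g.1, fun x y h => by
    apply f.2
    apply g.2
    simpa [SimplexCategory.comp_toOrderHom] using h⟩
  id_comp f := by apply Subtype.ext; simp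
  comp_id f := by apply Subtype.ext; simp
  assoc f g h := by apply Subtype.ext; simp

/-- The inclusion of the semisimplex category into the simplex category. -/
def SemiSimplexCat.ι : SemiSimplexCat ⥤ SimplexCategory where
  obj := SemiSimplexCat.toSimplex
  map f := f.1

/-- The category of semisimplicial sets (delta-complexes): contravariant functors
from `Δ₊` to the category of sets. -/
abbrev SemiSSet : Type 1 := SemiSimplexCatᵒᵖ ⥤ Type

/-- The forgetful functor `𝔣` from simplicial sets to semisimplicial sets,
given by restriction along `Δ₊ ↪ Δ` (forgetting degeneracy operators). -/
def SemiSSet.f : SSet.{0} ⥤ SemiSSet :=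
  (Functor.whiskeringLeft _ _ _).obj SemiSimplexCat.ι.op

/-- The functor `𝔡` freely adjoining degenerate simplices: the left Kan extension
along the inclusion `Δ₊ ↪ Δ`. -/
noncomputable def SemiSSet.d : SemiSSet ⥤ SSet.{0} :=
  SemiSimplexCat.ι.op.lan

/-- An injective map of `Δ`, as a morphism of `Δ₊`. -/
def auxHom {k n : SemiSimplexCat} (φ : SemiSimplexCat.ι.obj k ⟶ SemiSimplexCat.ι.obj n)
    (h : Function.Injective φ.toOrderHom) : k ⟶ n := ⟨φ, h⟩

open Classical in
/-- A simplicial set receiving an embedding from `Y`: an `n`-simplex assigns to every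
map `φ : [k] ⟶ [n]` either an element of `Y_k` or `none`. -/
noncomputable def auxSSet (Y : SemiSSet) : SSet.{0} where
  obj n := ∀ k : SemiSimplexCat, (SemiSimplexCat.ι.obj k ⟶ n.unop) → Option (Y.obj (op k))
  map θ := TypeCat.ofHom (fun x k φ => x k (φ ≫ θ.unop))
  map_id n := by ext x : 3; funext k φ; exact congrArg (x k) (Category.comp_id φ)
  map_comp f g := by
    ext x : 3; funext k φ; exact congrArg (x k) (Category.assoc φ g.unop f.unop).symm

open Classical in
/-- The component of the embedding `Y ⟶ 𝔣 (auxSSet Y)`: restrict along injective maps,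
and send the others to `none`. -/
noncomputable def auxFun (Y : SemiSSet) (n : SemiSimplexCat) (y : Y.obj (op n))
    (k : SemiSimplexCat) (φ : SemiSimplexCat.ι.obj k ⟶ SemiSimplexCat.ι.obj n) :
    Option (Y.obj (op k)) :=
  if h : Function.Injective φ.toOrderHom then
    some (Y.map (auxHom φ h).op y) else none

theorem auxFun_naturality (Y : SemiSSet) {m n : SemiSimplexCat} (θ : m ⟶ n)
    (y : Y.obj (op n)) (k : SemiSimplexCat)
    (φ : SemiSimplexCat.ι.obj k ⟶ SemiSimplexCat.ι.obj m) :
    auxFun Y m (Y.map θ.op y) k φ = auxFun Y n y k (φ ≫ SemiSimplexCat.ι.map θ) := by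
  unfold auxFun
  by_cases h : Function.Injective φ.toOrderHom
  · have hcomp : Function.Injective (φ ≫ SemiSimplexCat.ι.map θ).toOrderHom :=
      (auxHom φ h ≫ θ).2
    rw [dif_pos h, dif_pos hcomp]
    congr 1
    have e : auxHom (φ ≫ SemiSimplexCat.ι.map θ) hcomp =
      auxHom φ h ≫ θ := rfl
    rw [e, op_comp, Y.map_comp]
    rfl
  · have hcomp : ¬ Function.Injective (φ ≫ SemiSimplexCat.ι.map θ).toOrderHom := by
      intro hcomp
      apply h
      intro a b hab
      apply hcomp
      simp [SimplexCategory.comp_toOrderHom, hab]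
    rw [dif_neg h, dif_neg hcomp]

/-- The embedding `Y ⟶ 𝔣 (auxSSet Y)`. -/
noncomputable def auxMap (Y : SemiSSet) : Y ⟶ SemiSSet.f.obj (auxSSet Y) where
  app n := TypeCat.ofHom (fun y => (auxFun Y n.unop y :))
  naturality m n θ := by
    ext y : 3
    funext k φ
    exact auxFun_naturality Y θ.unop y k φ

theorem auxMap_injective (Y : SemiSSet) (n : SemiSimplexCat) :
    Function.Injective ((auxMap Y).app (op n)) := by
  intro a b hab
  have h1 : auxFun Y n a n (𝟙 _) = auxFun Y n b n (𝟙 _) :=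
    congrFun (congrFun hab n) (𝟙 _)
  have h : Function.Injective (SimplexCategory.Hom.toOrderHom (𝟙 (SemiSimplexCat.ι.obj n))) :=
    (show n ⟶ n from 𝟙 n).2
  unfold auxFun at h1
  rw [dif_pos h, dif_pos h] at h1
  have e : auxHom (𝟙 (SemiSimplexCat.ι.obj n)) h = 𝟙 n := rfl
  rw [e, op_id, Y.map_id] at h1
  exact Option.some.inj h1

/-- For every semisimplicial set `Y`, the unit `ι_Y : Y ⟶ 𝔣(𝔡(Y))` of the adjunction
`𝔡 ⊣ 𝔣` is a monomorphism: in every degree `n`, the map `Y_n → 𝔡(Y)_n` is injective,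
so `Y` embeds naturally into the underlying semisimplicial set of `𝔡(Y)`. -/
theorem unit_injective (adj : SemiSSet.d ⊣ SemiSSet.f) (Y : SemiSSet)
    (n : SemiSimplexCat) :
    Function.Injective ((adj.unit.app Y).app (op n)) := by
  intro a b hab
  apply auxMap_injective Y n
  have key := adj.homEquiv_unit (f := (adj.homEquiv _ _).symm (auxMap Y))
  rw [Equiv.apply_symm_apply] at key
  rw [key]
  simp only [NatTrans.comp_app, types_comp_apply]
  exact congrArg _ hab
end

section
/- For every semisimplicial set Y, the normalized chain complex N(𝔡(Y)) of the simplicial set 𝔡(Y) — the normalized Moore complex of the simplicial abelian group obtained by applying the free abelian group functor levelwise to 𝔡(Y) — is naturally isomorphic to the semisimplicial chain complex N(Y) of Y, whose group of n-chains is the free abelian group on Y_n and whose differential is the alternating sum of the face maps. -/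
open CategoryTheory Opposite AlgebraicTopology CategoryTheory.Preadditive

/-- The `i`-th coface map `[n] ⟶ [n+1]` in the semisimplex category. -/
def SemiSimplexCat.δ {n : ℕ} (i : Fin (n + 2)) :
    SemiSimplexCat.mk n ⟶ SemiSimplexCat.mk (n + 1) :=
  ⟨SimplexCategory.δ i, SimplexCategory.mono_iff_injective.mp
    (inferInstanceAs (Mono (SimplexCategory.δ i)))⟩

/-- The first simplicial identity in the semisimplex category. -/
theorem SemiSimplexCat.δ_comp_δ'' {n} {i : Fin (n + 3)} {j : Fin (n + 2)}
    (H : i ≤ Fin.castSucc j) :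
    δ (i.castLT (Nat.lt_of_le_of_lt (Fin.le_iff_val_le_val.mp H) j.is_lt)) ≫ δ j.succ =
      δ j ≫ δ i :=
  Subtype.ext (SimplexCategory.δ_comp_δ'' H)

namespace SemiSSet

/-- The `i`-th face map of the levelwise free abelian group on a semisimplicial set. -/
noncomputable def face (Y : SemiSSet) {n : ℕ} (i : Fin (n + 2)) :
    AddCommGrpCat.free.obj (Y.obj (op (SemiSimplexCat.mk (n + 1)))) ⟶
      AddCommGrpCat.free.obj (Y.obj (op (SemiSimplexCat.mk n))) :=
  AddCommGrpCat.free.map (Y.map (SemiSimplexCat.δ i).op)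

theorem face_comp'' (Y : SemiSSet) {n} {i : Fin (n + 3)} {j : Fin (n + 2)}
    (H : i ≤ Fin.castSucc j) :
    Y.face j.succ ≫
        Y.face (i.castLT (Nat.lt_of_le_of_lt (Fin.le_iff_val_le_val.mp H) j.is_lt)) =
      Y.face i ≫ Y.face j := by
  dsimp only [face]
  rw [← Functor.map_comp, ← Functor.map_comp, ← Functor.map_comp, ← Functor.map_comp,
    ← op_comp, ← op_comp, SemiSimplexCat.δ_comp_δ'' H]

/-- The differential of the semisimplicial chain complex: the alternating sum of the
face maps. -/
noncomputable def chainsD (Y : SemiSSet) (n : ℕ) :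
    AddCommGrpCat.free.obj (Y.obj (op (SemiSimplexCat.mk (n + 1)))) ⟶
      AddCommGrpCat.free.obj (Y.obj (op (SemiSimplexCat.mk n))) :=
  ∑ i : Fin (n + 2), (-1 : ℤ) ^ (i : ℕ) • Y.face i

theorem chainsD_squared (Y : SemiSSet) (n : ℕ) :
    Y.chainsD (n + 1) ≫ Y.chainsD n = 0 := by
  dsimp [chainsD]
  simp only [comp_sum, sum_comp, ← Finset.sum_product']
  let P := Fin (n + 2) × Fin (n + 3)
  let S := Finset.univ.filter fun ij : P => (ij.2 : ℕ) ≤ (ij.1 : ℕ)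
  erw [← Finset.sum_add_sum_compl S, ← eq_neg_iff_add_eq_zero, ← Finset.sum_neg_distrib]
  let φ : ∀ ij : P, ij ∈ S → P := fun ij hij =>
    (Fin.castLT ij.2 (lt_of_le_of_lt (Finset.mem_filter.mp hij).right (Fin.is_lt ij.1)), ij.1.succ)
  apply Finset.sum_bij φ
  · intro ij hij
    simp only [S, φ, Finset.mem_univ, Finset.compl_filter, Finset.mem_filter, true_and,
      Fin.val_succ, Fin.val_castLT] at hij ⊢
    linarith
  · rintro ⟨i, j⟩ hij ⟨i', j'⟩ hij' h
    rw [Prod.mk_inj]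
    exact ⟨by simpa [φ] using congr_arg Prod.snd h,
      by simpa [φ, Fin.castSucc_castLT] using congr_arg Fin.castSucc (congr_arg Prod.fst h)⟩
  · rintro ⟨i', j'⟩ hij'
    simp only [S, Finset.mem_univ, forall_true_left, Prod.forall, Finset.compl_filter,
      not_le, Finset.mem_filter, true_and] at hij'
    refine ⟨(j'.pred <| ?_, Fin.castSucc i'), ?_, ?_⟩
    · rintro rfl
      simp only [Fin.val_zero, not_lt_zero'] at hij'
    · simpa only [S, Finset.mem_univ, forall_true_left, Prod.forall, Finset.mem_filter,
        Fin.coe_castSucc, Fin.coe_pred, true_and] using Nat.le_sub_one_of_lt hij'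
    · simp only [φ, Fin.castLT_castSucc, Fin.succ_pred]
  · rintro ⟨i, j⟩ hij
    dsimp
    simp only [zsmul_comp, comp_zsmul, smul_smul, ← neg_smul]
    congr 1
    · simp only [φ, Fin.val_succ, pow_add, pow_one, mul_neg, neg_neg, mul_one]
      apply mul_comm
    · rw [face_comp'']
      simpa [S] using! hij

/-- The semisimplicial chain complex of a semisimplicial set `Y`: its group of `n`-chains
is the free abelian group on `Y_n` and its differential is the alternating sum of the
face maps. -/
noncomputable def chains (Y : SemiSSet) : ChainComplex AddCommGrpCat ℕ :=
  ChainComplex.of (fun n => AddCommGrpCat.free.obj (Y.obj (op (SemiSimplexCat.mk n))))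
    Y.chainsD Y.chainsD_squared

/-- The semisimplicial chain complex, as a functor. -/
noncomputable def chainsFunctor : SemiSSet ⥤ ChainComplex AddCommGrpCat ℕ where
  obj := chains
  map {Y Y'} g := ChainComplex.ofHom
    (fun n => AddCommGrpCat.free.map (g.app (op (SemiSimplexCat.mk n))))
    (fun n => by
      simp only [chains, ChainComplex.of_d]
      dsimp [chainsD, face]
      rw [comp_sum, sum_comp]
      refine Finset.sum_congr rfl fun i _ => ?_
      rw [comp_zsmul, zsmul_comp]
      congr 1
      rw [← Functor.map_comp, ← Functor.map_comp, g.naturality])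
  map_id Y := by
    ext n : 1
    exact AddCommGrpCat.free.map_id _
  map_comp g h := by
    ext n : 1
    exact AddCommGrpCat.free.map_comp _ _

end SemiSSet

/-- The normalized chain complex functor `N`: the normalized Moore complex of the
levelwise free abelian group on a simplicial set. -/
noncomputable def SSet.normalizedChains : SSet.{0} ⥤ ChainComplex AddCommGrpCat ℕ :=
  ((SimplicialObject.whiskering _ _).obj AddCommGrpCat.free) ⋙
    normalizedMooreComplex AddCommGrpCat

open CategoryTheory.Limits Simplicial SimplicialObject AlgebraicTopology.DoldKan

namespace SemiSSetAux

/-- A monomorphism of the simplex category, as a morphism of the semisimplex category. -/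
def ofMono {a b : SimplexCategory} (i : a ⟶ b) (hi : Mono i) :
    @Quiver.Hom SemiSimplexCat _ a b :=
  ⟨i, SimplexCategory.mono_iff_injective.mp hi⟩

/-- The nondegenerate simplices of `𝔡 Y`. -/
abbrev nd (Y : SemiSSet) (n : ℕ) : Type := Y.obj (op (SemiSimplexCat.mk n))

/-- The unit, evaluated in degree `n`. -/
noncomputable def unit (Y : SemiSSet) (n : ℕ) :
    nd Y n ⟶ (SemiSSet.d.obj Y).obj (op (SimplexCategory.mk n)) :=
  (SemiSimplexCat.ι.op.lanUnit.app Y).app (op (SemiSimplexCat.mk n))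

/-- The composition `Y_b → Y_a → T` attached to a factorization. -/
def comp (Y : SemiSSet) {Δ : SimplexCategory} (t : Cofan (Splitting.summand (nd Y) (op Δ)))
    {a b : SimplexCategory} (e : Δ ⟶ a) (he : Epi e) (i : a ⟶ b) (hi : Mono i) :
    (Y.obj (op b) : Type) ⟶ t.pt :=
  Y.map (ofMono i hi).op ≫ t.inj (Splitting.IndexSet.mk e)

lemma comp_eq (Y : SemiSSet) {Δ : SimplexCategory}
    (t : Cofan (Splitting.summand (nd Y) (op Δ)))
    {a b : SimplexCategory} (e : Δ ⟶ a) (he : Epi e) (i : a ⟶ b) (hi : Mono i)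
    {a' : SimplexCategory} (e' : Δ ⟶ a') (he' : Epi e') (i' : a' ⟶ b) (hi' : Mono i')
    (h : e ≫ i = e' ≫ i') : comp Y t e he i hi = comp Y t e' he' i' hi' := by
  have h1 := SimplexCategory.image_eq h
  have h2 := SimplexCategory.image_eq (φ := e' ≫ i') rfl
  obtain rfl : a = a' := h1.symm.trans h2
  have := strongEpi_of_epi e
  have := strongEpi_of_epi e'
  let u := image.isoStrongEpiMono e i h
  let v := image.isoStrongEpiMono e' i' (f := e' ≫ i') rfl
  have huv : u.hom ≫ v.inv = 𝟙 _ := SimplexCategory.eq_id_of_isIso _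
  have huv' : u.hom = v.hom := by rw [← Iso.comp_inv_eq_id, huv]
  obtain rfl : i = i' :=
    (image.isoStrongEpiMono_hom_comp_ι e i h).symm.trans
      ((congrArg (· ≫ image.ι _) huv').trans
        (image.isoStrongEpiMono_hom_comp_ι e' i' (f := e' ≫ i') rfl))
  obtain rfl : e = e' := (cancel_mono i).1 h
  rfl

lemma map_comp (Y : SemiSSet) {Δ : SimplexCategory}
    (t : Cofan (Splitting.summand (nd Y) (op Δ)))
    {a b c : SimplexCategory} (e : Δ ⟶ a) (he : Epi e) (i : a ⟶ b) (hi : Mono i)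
    (j : b ⟶ c) (hj : Mono j) (h : Mono (i ≫ j)) :
    Y.map (ofMono j hj).op ≫ comp Y t e he i hi = comp Y t e he (i ≫ j) h := by
  exact (Category.assoc _ _ _).symm.trans
    (congrArg (· ≫ t.inj (Splitting.IndexSet.mk e))
      (Y.map_comp (ofMono j hj).op (ofMono i hi).op).symm)

/-- The map `Y_b → T` attached to any map `Δ ⟶ b`. -/
noncomputable def compf (Y : SemiSSet) {Δ : SimplexCategory}
    (t : Cofan (Splitting.summand (nd Y) (op Δ))) {b : SimplexCategory} (f : Δ ⟶ b) :
    (Y.obj (op b) : Type) ⟶ t.pt :=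
  comp Y t (factorThruImage f) inferInstance (image.ι f) inferInstance

lemma map_compf (Y : SemiSSet) {Δ : SimplexCategory}
    (t : Cofan (Splitting.summand (nd Y) (op Δ)))
    {b c : SimplexCategory} (f : Δ ⟶ b) (j : b ⟶ c) (hj : Mono j) :
    Y.map (ofMono j hj).op ≫ compf Y t f = compf Y t (f ≫ j) := by
  refine (map_comp Y t _ _ _ _ j hj (mono_comp _ _)).trans (comp_eq Y t _ _ _ _ _ _ _ _ ?_)
  rw [← Category.assoc, image.fac, image.fac]

lemma compf_epi (Y : SemiSSet) {Δ : SimplexCategory}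
    (t : Cofan (Splitting.summand (nd Y) (op Δ)))
    {b : SimplexCategory} (f : Δ ⟶ b) (hf : Epi f) :
    compf Y t f = t.inj (Splitting.IndexSet.mk f) := by
  refine (comp_eq Y t _ _ _ _ f hf (𝟙 _) inferInstance ?_).trans ?_
  · rw [image.fac, Category.comp_id]
  · exact (congrArg (· ≫ t.inj (Splitting.IndexSet.mk f)) (Y.map_id _)).trans (Category.id_comp _)

/-- The pointwise formula. -/
noncomputable def isColim (Y : SemiSSet) (Δ : SimplexCategoryᵒᵖ) :
    IsColimit ((Functor.LeftExtension.mk _ (SemiSimplexCat.ι.op.leftKanExtensionUnit Y)).coconeAt Δ) :=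
  SemiSimplexCat.ι.op.isPointwiseLeftKanExtensionLeftKanExtensionUnit Y Δ

/-- The cocone on costructured arrows induced by a cofan. -/
noncomputable def cocone (Y : SemiSSet) (Δ : SimplexCategory)
    (t : Cofan (Splitting.summand (nd Y) (op Δ))) :
    Cocone (CostructuredArrow.proj SemiSimplexCat.ι.op (op Δ) ⋙ Y) where
  pt := t.pt
  ι :=
    { app a := compf Y t a.hom.unop
      naturality a b f := by
        have hf : Mono f.left.unop.1 := SimplexCategory.mono_iff_injective.mpr f.left.unop.2
        refine (map_compf Y t b.hom.unop f.left.unop.1 hf).trans ?_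
        exact (congrArg (fun g => compf Y t g)
          (congrArg Quiver.Hom.unop (CostructuredArrow.w f))).trans (Category.comp_id _).symm }

lemma inj_eq (Y : SemiSSet) (Δ : SimplexCategory) (A : Splitting.IndexSet (op Δ)) :
    (Splitting.cofan' (nd Y) (SemiSSet.d.obj Y) (unit Y) (op Δ)).inj A =
      ((Functor.LeftExtension.mk _
        (SemiSimplexCat.ι.op.leftKanExtensionUnit Y)).coconeAt (op Δ)).ι.app
        (CostructuredArrow.mk (S := SemiSimplexCat.ι.op) (T := op Δ)
          (Y := op (SemiSimplexCat.mk A.1.unop.len)) A.e.op) := rfl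

lemma desc_lemma {C : Type*} [Category C] {a b x y : C} {ia : a ⟶ x} {ib : b ⟶ x} {u : a ⟶ b}
    {m : x ⟶ y} {z : b ⟶ y} (w : ia = u ≫ ib) (h : ib ≫ m = z) : ia ≫ m = u ≫ z := by
  rw [w, Category.assoc, h]

/-- The splitting of `𝔡 Y`. -/
noncomputable def splitting (Y : SemiSSet) : Splitting (SemiSSet.d.obj Y) where
  N := nd Y
  ι := unit Y
  isColimit' Δ := by
    induction Δ using Opposite.rec with | _ Δ
    refine Cofan.IsColimit.mk _ (fun t => (isColim Y (op Δ)).desc (cocone Y Δ t)) ?_ ?_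
    · intro t A
      rw [inj_eq]
      refine ((isColim Y (op Δ)).fac (cocone Y Δ t) _).trans ?_
      exact compf_epi Y t A.e inferInstance
    · intro t m hm
      refine (isColim Y (op Δ)).hom_ext fun a => ?_
      refine Eq.trans ?_ ((isColim Y (op Δ)).fac (cocone Y Δ t) a).symm
      refine desc_lemma ?_ (hm (Splitting.IndexSet.mk (factorThruImage a.hom.unop)))
      refine (((Functor.LeftExtension.mk _
        (SemiSimplexCat.ι.op.leftKanExtensionUnit Y)).coconeAt (op Δ)).w
          (CostructuredArrow.homMk (ofMono (image.ι a.hom.unop) inferInstance).op ?_ :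
            a ⟶ CostructuredArrow.mk (S := SemiSimplexCat.ι.op) (T := op Δ)
              (Y := op (SemiSimplexCat.mk (image a.hom.unop).len))
              (factorThruImage a.hom.unop).op)).symm
      exact Quiver.Hom.unop_inj (image.fac _)

/-- The free simplicial abelian group on `𝔡 Y`. -/
noncomputable abbrev fr (Y : SemiSSet) : SimplicialObject AddCommGrpCat :=
  ((SimplicialObject.whiskering _ _).obj AddCommGrpCat.free).obj (SemiSSet.d.obj Y)

noncomputable def frSplitting (Y : SemiSSet) : Splitting (fr Y) :=
  haveI : PreservesFiniteCoproducts AddCommGrpCat.free.{0} := by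
    have := AddCommGrpCat.adj.{0}.leftAdjoint_preservesColimits
    infer_instance
  (splitting Y).map AddCommGrpCat.free

lemma unit_face (Y : SemiSSet) (n : ℕ) (i : Fin (n + 2)) :
    unit Y (n + 1) ≫ (SemiSSet.d.obj Y).δ i = Y.map (SemiSimplexCat.δ i).op ≫ unit Y n :=
  ((SemiSimplexCat.ι.op.lanUnit.app Y).naturality (SemiSimplexCat.δ i).op).symm

lemma unit_natural {Y Z : SemiSSet} (g : Y ⟶ Z) (n : ℕ) :
    unit Y n ≫ (SemiSSet.d.map g).app _ = g.app _ ≫ unit Z n :=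
  (NatTrans.congr_app (SemiSimplexCat.ι.op.lanUnit.naturality g) (op (SemiSimplexCat.mk n))).symm

lemma sum_lemma {C : Type*} [Category C] [Preadditive C] {a b a' b' : C} {ι : Type*} [Fintype ι]
    (u : a ⟶ b) (v : a' ⟶ b') (f : ι → (b ⟶ b')) (g : ι → (a ⟶ a')) (c : ι → ℤ)
    (h : ∀ i, u ≫ f i = g i ≫ v) : u ≫ ∑ i, c i • f i = (∑ i, c i • g i) ≫ v := by
  rw [comp_sum, sum_comp]
  refine Finset.sum_congr rfl fun i _ => ?_
  rw [comp_zsmul, zsmul_comp, h]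

lemma iso_lemma {C : Type*} [Category C] {n x m : C} (i : n ⟶ x) (p : x ⟶ x) (r : x ⟶ m)
    (j : m ⟶ x) (π : x ⟶ n) (e1 : r ≫ j = p) (e2 : j ≫ r = 𝟙 _) (e3 : p ≫ r = r)
    (e4 : π ≫ i ≫ p = p) (e5 : p ≫ π = π) (e6 : i ≫ π = 𝟙 _) : IsIso (i ≫ r) := by
  refine ⟨j ≫ π, ?_, ?_⟩
  · rw [Category.assoc, ← Category.assoc r, e1, e5, e6]
  · rw [← e3, Category.assoc, ← Category.assoc i, ← Category.assoc π, e4, e3, e2]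

lemma nat_lemma {C : Type*} [Category C] {a b c a' b' c' : C} {f : a ⟶ a'} {t' : a' ⟶ b'}
    {p' : b' ⟶ c'} {t : a ⟶ b} {p : b ⟶ c} {k : b ⟶ b'} {m : c ⟶ c'}
    (h : f ≫ t' = t ≫ k) (h' : k ≫ p' = p ≫ m) : f ≫ t' ≫ p' = (t ≫ p) ≫ m := by
  rw [← Category.assoc, h, Category.assoc, h', Category.assoc]

/-- The chain map from semisimplicial chains to the unnormalized chains. -/
noncomputable def toK (Y : SemiSSet) :
    Y.chains ⟶ (alternatingFaceMapComplex AddCommGrpCat).obj (fr Y) :=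
  ChainComplex.ofHom (fun n => AddCommGrpCat.free.map (unit Y n)) (fun n => by
    rw [alternatingFaceMapComplex_obj_d]
    simp only [SemiSSet.chains, ChainComplex.of_d]
    dsimp only [SemiSSet.chainsD, SemiSSet.face, AlternatingFaceMapComplex.objD]
    refine sum_lemma _ _ _ _ _ fun i => ?_
    exact ((AddCommGrpCat.free.map_comp _ _).symm.trans
      (congrArg (fun g => AddCommGrpCat.free.map g) (unit_face Y n i))).trans
      (AddCommGrpCat.free.map_comp _ _))

lemma toK_f (Y : SemiSSet) (n : ℕ) : (toK Y).f n = (frSplitting Y).ι n := rfl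

/-- The comparison map. -/
noncomputable def φ (Y : SemiSSet) : Y.chains ⟶ (normalizedMooreComplex _).obj (fr Y) :=
  toK Y ≫ PInftyToNormalizedMooreComplex (fr Y)

instance (Y : SemiSSet) (n : ℕ) : IsIso ((φ Y).f n) := by
  let s := frSplitting Y
  have e1 : (PInftyToNormalizedMooreComplex (fr Y)).f n ≫ (inclusionOfMooreComplexMap (fr Y)).f n
      = PInfty.f n := HomologicalComplex.congr_hom
    (PInftyToNormalizedMooreComplex_comp_inclusionOfMooreComplexMap (fr Y)) n
  have e2 : (inclusionOfMooreComplexMap (fr Y)).f n ≫ (PInftyToNormalizedMooreComplex (fr Y)).f n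
      = 𝟙 _ := HomologicalComplex.congr_hom
    (splitMonoInclusionOfMooreComplexMap (fr Y)).id n
  have e3 : PInfty.f n ≫ (PInftyToNormalizedMooreComplex (fr Y)).f n
      = (PInftyToNormalizedMooreComplex (fr Y)).f n := HomologicalComplex.congr_hom
    (PInfty_comp_PInftyToNormalizedMooreComplex (fr Y)) n
  have e4 := s.πSummand_comp_cofan_inj_id_comp_PInfty_eq_PInfty n
  have e5 := s.PInfty_comp_πSummand_id n
  have e6 := s.cofan_inj_πSummand_eq_id (Splitting.IndexSet.id (op ⦋n⦌))
  rw [s.cofan_inj_id] at e4 e6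
  exact iso_lemma (x := (fr Y).obj (op ⦋n⦌)) (s.ι n) ((PInfty (X := fr Y)).f n) _ _ _ e1 e2 e3 e4 e5 e6

instance isIso_φ (Y : SemiSSet) : IsIso (φ Y) := HomologicalComplex.Hom.isIso_of_components _

/-- The comparison isomorphism. -/
noncomputable def φIso (Y : SemiSSet) :
    SemiSSet.chainsFunctor.obj Y ≅ (SemiSSet.d ⋙ SSet.normalizedChains).obj Y :=
  @asIso _ _ _ _ (φ Y) (isIso_φ Y)

lemma φ_natural {Y Z : SemiSSet} (g : Y ⟶ Z) :
    SemiSSet.chainsFunctor.map g ≫ φ Z = φ Y ≫ (SemiSSet.d ⋙ SSet.normalizedChains).map g := by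
  have h : SemiSSet.chainsFunctor.map g ≫ toK Z = toK Y ≫ AlternatingFaceMapComplex.map
      (((SimplicialObject.whiskering _ _).obj AddCommGrpCat.free).map (SemiSSet.d.map g)) := by
    ext n : 1
    change AddCommGrpCat.free.map _ ≫ AddCommGrpCat.free.map _ =
      AddCommGrpCat.free.map _ ≫ AddCommGrpCat.free.map _
    rw [← Functor.map_comp, ← Functor.map_comp]
    exact congrArg _ (unit_natural g n).symm
  exact nat_lemma h (PInftyToNormalizedMooreComplex_naturality _)

end SemiSSetAux

/-- For every semisimplicial set `Y`, the normalized chain complex `N(𝔡(Y))` of the free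
simplicial set `𝔡(Y)` is naturally isomorphic to the semisimplicial chain complex `N(Y)`
(free abelian group on `Y_n` in degree `n`, differential the alternating sum of faces). -/
theorem normalizedChains_d_iso_chains :
    Nonempty (SemiSSet.d ⋙ SSet.normalizedChains ≅ SemiSSet.chainsFunctor) :=
  ⟨(NatIso.ofComponents (fun Y => SemiSSetAux.φIso Y)
    (fun g => SemiSSetAux.φ_natural g)).symm⟩
end

section
/- For every simplicial set X, the counit map g : 𝔡(𝔣(X)) → X of the adjunction 𝔡 ⊣ 𝔣 — the natural map from the simplicial set obtained by forgetting the degeneracies of X and then freely adjoining new degenerate simplices back to X — induces a homotopy equivalence |g| : |𝔡(𝔣(X))| → |X| of geometric realizations. -/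
open CategoryTheory Opposite

/-- A continuous map is a homotopy equivalence if it admits a homotopy inverse. -/
def IsHomotopyEquivalence {A B : Type*} [TopologicalSpace A] [TopologicalSpace B]
    (f : C(A, B)) : Prop :=
  ∃ g : C(B, A), (g.comp f).Homotopic (ContinuousMap.id A) ∧
    (f.comp g).Homotopic (ContinuousMap.id B)

section PartA
open CategoryTheory Opposite

/-- Homotopy lifting property (Hurewicz fibration, for small test spaces). -/
def HLP {E B : Type} [TopologicalSpace E] [TopologicalSpace B] (p : C(E, B)) : Prop :=
  ∀ (A : Type) [TopologicalSpace A] (G : C(A, E)) (H : C(A × unitInterval, B)),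
    (∀ x, H (x, 0) = p (G x)) →
    ∃ L : C(A × unitInterval, E), (∀ x, L (x, 0) = G x) ∧ ∀ z, p (L z) = H z

section
variable {n : ℕ} (k : Fin (n + 2))

lemma hornErase_nonempty : (Finset.univ.erase k).Nonempty := by
  obtain ⟨j, hj⟩ := exists_ne k
  exact ⟨j, by simp [hj]⟩

/-- The minimal coordinate among those different from `k`. -/
noncomputable def hornMin (x : Fin (n + 2) → ℝ) : ℝ :=
  (Finset.univ.erase k).inf' (hornErase_nonempty k) x

lemma continuous_hornMin : Continuous (hornMin k) := by
  unfold hornMin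
  exact Continuous.finset_inf'_apply _ (fun i _ => continuous_apply i)

lemma hornMin_le {j : Fin (n + 2)} (hj : j ≠ k) (x : Fin (n + 2) → ℝ) : hornMin k x ≤ x j :=
  Finset.inf'_le _ (by simp [hj])

lemma exists_hornMin (x : Fin (n + 2) → ℝ) : ∃ j, j ≠ k ∧ hornMin k x = x j := by
  obtain ⟨j, hj, h⟩ := Finset.exists_mem_eq_inf' (hornErase_nonempty k) x
  exact ⟨j, by simpa using hj, h⟩

lemma hornMin_mem (x : stdSimplex ℝ (Fin (n + 2))) : hornMin k x ∈ Set.Icc (0 : ℝ) 1 := by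
  obtain ⟨j, hj, h⟩ := exists_hornMin k x
  rw [h]
  exact mem_Icc_of_mem_stdSimplex x.2 j

/-- Push `x` by `c` in the direction of the horn retraction. -/
noncomputable def hornPush (x : Fin (n + 2) → ℝ) (c : ℝ) : Fin (n + 2) → ℝ :=
  fun j => if j = k then x j + (n + 1) * c else x j - c

lemma hornPush_mem (x : stdSimplex ℝ (Fin (n + 2))) (c : ℝ) (hc : 0 ≤ c) (hc' : c ≤ hornMin k x) :
    hornPush k x c ∈ stdSimplex ℝ (Fin (n + 2)) := by
  constructor
  · intro j
    unfold hornPush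
    split_ifs with h
    · have := x.2.1 j
      positivity
    · have := hornMin_le k h x
      linarith
  · have h1 := x.2.2
    have : ∀ j, hornPush k x c j = (x.1 j - c) + (if j = k then (n + 2) * c else 0) := by
      intro j
      unfold hornPush
      split_ifs
      · change x.1 j + _ = _
        ring
      · change x.1 j - _ = _
        ring
    simp_rw [this]
    rw [Finset.sum_add_distrib, Finset.sum_sub_distrib, h1]
    simp

/-- The deformation of the simplex. -/
noncomputable def hornDef (z : stdSimplex ℝ (Fin (n + 2)) × unitInterval) :
    stdSimplex ℝ (Fin (n + 2)) :=
  ⟨hornPush k z.1 (max (hornMin k z.1 - z.2) 0), hornPush_mem k _ _ (le_max_right _ _) (by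
    have := (hornMin_mem k z.1).1
    have := z.2.2.1
    apply max_le <;> linarith)⟩

lemma continuous_hornDef : Continuous (hornDef k) := by
  unfold hornDef
  refine Continuous.subtype_mk ?_ _
  have h1 : Continuous fun z : stdSimplex ℝ (Fin (n + 2)) × unitInterval =>
      max (hornMin k z.1 - (z.2 : ℝ)) 0 := by
    have := continuous_hornMin k
    have h : Continuous fun z : stdSimplex ℝ (Fin (n + 2)) × unitInterval => hornMin k z.1 :=
      this.comp (continuous_subtype_val.comp continuous_fst)
    fun_prop
  refine continuous_pi fun j => ?_
  unfold hornPush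
  have h2 : Continuous fun z : stdSimplex ℝ (Fin (n + 2)) × unitInterval => z.1.1 j :=
    (continuous_apply j).comp (continuous_subtype_val.comp continuous_fst)
  split_ifs
  · exact h2.add (continuous_const.mul h1)
  · exact h2.sub h1

lemma hornDef_min (x : stdSimplex ℝ (Fin (n + 2))) (t : unitInterval)
    (ht : hornMin k x ≤ t) : hornDef k (x, t) = x := by
  apply Subtype.ext
  funext j
  simp only [hornDef, hornPush]
  rw [max_eq_right (by linarith)]
  split_ifs <;> simp <;> rfl

lemma exists_hornDef_zero (x : stdSimplex ℝ (Fin (n + 2))) :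
    ∃ j, j ≠ k ∧ (hornDef k (x, 0)).1 j = 0 := by
  obtain ⟨j, hj, h⟩ := exists_hornMin k x
  refine ⟨j, hj, ?_⟩
  simp only [hornDef, hornPush]
  have := (hornMin_mem k x).1
  rw [if_neg hj]
  rw [max_eq_left (by simpa using this), ← h]
  simp

theorem horn_core {E B : Type} [TopologicalSpace E] [TopologicalSpace B] (p : C(E, B))
    (hp : HLP p) (F : Fin (n + 2) → C(stdSimplex ℝ (Fin (n + 2)), E))
    (b : C(stdSimplex ℝ (Fin (n + 2)), B))
    (hF : ∀ i j, i ≠ k → j ≠ k → ∀ z : stdSimplex ℝ (Fin (n + 2)), z.1 i = 0 → z.1 j = 0 →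
      F i z = F j z)
    (hb : ∀ j, j ≠ k → ∀ z : stdSimplex ℝ (Fin (n + 2)), z.1 j = 0 → p (F j z) = b z) :
    ∃ l : C(stdSimplex ℝ (Fin (n + 2)), E), (∀ z, p (l z) = b z) ∧
      ∀ j, j ≠ k → ∀ z : stdSimplex ℝ (Fin (n + 2)), z.1 j = 0 → l z = F j z := by
  choose J hJ hJ' using exists_hornDef_zero (n := n) k
  let r : stdSimplex ℝ (Fin (n + 2)) → stdSimplex ℝ (Fin (n + 2)) := fun x => hornDef k (x, 0)
  have hr : Continuous r := (continuous_hornDef k).comp (by fun_prop)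
  let G : stdSimplex ℝ (Fin (n + 2)) → E := fun x => F (J x) (r x)
  have hGj : ∀ j, j ≠ k → ∀ x, (r x).1 j = 0 → G x = F j (r x) := fun j hj x hx =>
    hF _ _ (hJ x) hj _ (hJ' x) hx
  have hG : Continuous G := by
    refine (locallyFinite_of_finite
      (fun j : {j : Fin (n + 2) // j ≠ k} => {x | (r x).1 j = 0})).continuous ?_ ?_ ?_
    · ext x
      simp only [Set.mem_iUnion, Set.mem_univ, iff_true]
      exact ⟨⟨J x, hJ x⟩, hJ' x⟩
    · intro j
      exact isClosed_eq ((continuous_apply _).comp (continuous_subtype_val.comp hr))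
        continuous_const
    · intro j
      refine ContinuousOn.congr (f := fun x => F j (r x)) ?_ (fun x hx => hGj j j.2 x hx)
      exact ((F j).continuous.comp hr).continuousOn
  obtain ⟨L, hL0, hL⟩ := hp _ ⟨G, hG⟩ (b.comp ⟨hornDef k, continuous_hornDef k⟩)
    (fun x => (hb _ (hJ x) _ (hJ' x)).symm)
  let m : stdSimplex ℝ (Fin (n + 2)) → unitInterval := fun x => ⟨hornMin k x, hornMin_mem k x⟩
  have hm : Continuous m :=
    Continuous.subtype_mk ((continuous_hornMin k).comp continuous_subtype_val) _
  refine ⟨⟨fun x => L (x, m x), by fun_prop⟩, ?_, ?_⟩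
  · intro z
    refine (hL (z, m z)).trans ?_
    change b (hornDef k (z, m z)) = _
    rw [hornDef_min k z (m z) le_rfl]
  · intro j hj z hz
    have h0 : m z = 0 := by
      apply Subtype.ext
      apply le_antisymm _ (hornMin_mem k z).1
      exact (hornMin_le k hj z).trans (le_of_eq hz)
    rw [ContinuousMap.coe_mk, h0, hL0]
    have : r z = z := hornDef_min k z 0 (le_of_eq (congrArg Subtype.val h0))
    change G z = _
    rw [hGj j hj z (by rw [this]; exact hz), this]

end

/-- A monotone retraction of `Fin (n+1)` onto the nonempty finset `S`. -/
def finRetract {n : ℕ} (S : Finset (Fin (n + 1))) (hS : S.Nonempty) (x : Fin (n + 1)) :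
    Fin (n + 1) :=
  if h : (S.filter (· ≤ x)).Nonempty then (S.filter (· ≤ x)).max' h else S.min' hS

lemma finRetract_mem {n : ℕ} (S : Finset (Fin (n + 1))) (hS : S.Nonempty) (x : Fin (n + 1)) :
    finRetract S hS x ∈ S := by
  unfold finRetract
  split_ifs with h
  · exact (Finset.mem_filter.1 (Finset.max'_mem _ h)).1
  · exact Finset.min'_mem _ _

lemma finRetract_of_mem {n : ℕ} (S : Finset (Fin (n + 1))) (hS : S.Nonempty) (x : Fin (n + 1))
    (hx : x ∈ S) : finRetract S hS x = x := by
  unfold finRetract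
  have h : (S.filter (· ≤ x)).Nonempty := ⟨x, by simp [hx]⟩
  rw [dif_pos h]
  apply le_antisymm
  · exact (Finset.mem_filter.1 (Finset.max'_mem _ h)).2
  · exact Finset.le_max' _ _ (by simp [hx])

lemma finRetract_mono {n : ℕ} (S : Finset (Fin (n + 1))) (hS : S.Nonempty) :
    Monotone (finRetract S hS) := by
  intro x y hxy
  unfold finRetract
  split_ifs with h h' h'
  · apply Finset.max'_subset
    intro z hz
    simp only [Finset.mem_filter] at hz ⊢
    exact ⟨hz.1, hz.2.trans hxy⟩
  · obtain ⟨z, hz⟩ := h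
    simp only [Finset.mem_filter] at hz
    exact absurd ⟨z, by simp [hz.1, hz.2.trans hxy]⟩ h'
  · exact Finset.min'_le _ _ (Finset.mem_filter.1 (Finset.max'_mem _ h')).1
  · exact le_rfl

/-- The retraction as a morphism in the simplex category. -/
def simplexRetract {n : ℕ} (S : Finset (Fin (n + 1))) (hS : S.Nonempty) :
    SimplexCategory.mk n ⟶ SimplexCategory.mk n :=
  SimplexCategory.Hom.mk ⟨finRetract S hS, finRetract_mono S hS⟩

lemma stdSimplex_map_simplexRetract {n : ℕ} (S : Finset (Fin (n + 1))) (hS : S.Nonempty)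
    (z : stdSimplex ℝ (Fin (n + 1))) (hz : ∀ j, j ∉ S → z.1 j = 0) :
    stdSimplex.map (finRetract S hS) z = z := by
  apply Subtype.ext
  change FunOnFinite.linearMap ℝ ℝ (finRetract S hS) z = z.1
  funext j
  rw [FunOnFinite.linearMap_apply_apply]
  by_cases hj : j ∈ S
  · rw [Finset.sum_eq_single j]
    · rfl
    · intro i hi hij
      apply hz
      intro hiS
      apply hij
      rw [Finset.mem_filter, finRetract_of_mem _ _ _ hiS] at hi
      exact hi.2
    · intro h
      simp [finRetract_of_mem S hS j hj] at h
  · rw [Finset.sum_eq_zero, hz j hj]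
    intro i hi
    rw [Finset.mem_filter] at hi
    exact absurd (hi.2 ▸ finRetract_mem S hS i) hj

end PartA

section PartB
open CategoryTheory Opposite Simplicial HomotopicalAlgebra
open SSet.modelCategoryQuillen

section

variable {n : ℕ} (k : Fin (n + 2))

/-- The simplex of the horn given by the retraction onto `S`. -/
def hornSimplex (S : Finset (Fin (n + 2))) (hS : S.Nonempty) (j : Fin (n + 2)) (hj : j ≠ k)
    (hjS : j ∉ S) : (Λ[n + 1, k] : SSet.{0}).obj (op (SimplexCategory.mk (n + 1))) :=
  ⟨SSet.stdSimplex.objEquiv.symm (simplexRetract S hS), by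
    rw [SSet.mem_horn_iff_notMem_range]
    refine ⟨j, hj, ?_⟩
    rintro ⟨x, hx⟩
    apply hjS
    rw [← hx]
    exact finRetract_mem S hS x⟩

lemma hornSimplex_map (S T : Finset (Fin (n + 2))) (hS : S.Nonempty) (hT : T.Nonempty)
    (hST : S ⊆ T) (j : Fin (n + 2)) (hj : j ≠ k)
    (hjS : j ∉ S) (hjT : j ∉ T) :
    (Λ[n + 1, k] : SSet.{0}).map (simplexRetract S hS).op (hornSimplex k T hT j hj hjT) =
      hornSimplex k S hS j hj hjS := by
  apply Subtype.ext
  apply SSet.stdSimplex.objEquiv.injective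
  apply SimplexCategory.Hom.ext
  apply OrderHom.ext
  funext x
  exact finRetract_of_mem T hT _ (hST (finRetract_mem S hS x))

lemma hornSimplex_cover {m : SimplexCategory} (s : (Λ[n + 1, k] : SSet.{0}).obj (op m)) :
    ∃ (j : Fin (n + 2)) (hj : j ≠ k) (f : m ⟶ SimplexCategory.mk (n + 1)),
      s = (Λ[n + 1, k] : SSet.{0}).map f.op
        (hornSimplex k ({j}ᶜ) ⟨k, by simpa using hj.symm⟩ j hj (by simp)) := by
  have h := s.2
  obtain ⟨f, hf⟩ := SSet.stdSimplex.objEquiv.symm.surjective s.1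
  induction m using SimplexCategory.rec with | _ m
  rw [SSet.mem_horn_iff_notMem_range] at h
  obtain ⟨j, hj, h⟩ := h
  refine ⟨j, hj, f, ?_⟩
  apply Subtype.ext
  rw [← hf]
  apply SSet.stdSimplex.objEquiv.injective
  apply SimplexCategory.Hom.ext
  apply OrderHom.ext
  funext x
  refine (finRetract_of_mem ({j}ᶜ) ⟨k, by simpa using hj.symm⟩ _ ?_).symm
  simp only [Finset.mem_compl, Finset.mem_singleton]
  intro h'
  apply h
  refine ⟨x, ?_⟩
  rw [← hf]
  exact h'

end

theorem fibration_toSSet_map {E B : TopCat.{0}} (p : E ⟶ B) (hp : HLP p.hom) :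
    Fibration (TopCat.toSSet.map p) := by
  rw [fibration_iff]
  intro A C i hi
  simp only [J, MorphismProperty.iSup_iff] at hi
  obtain ⟨n, ⟨k⟩⟩ := hi
  constructor
  intro h b sq
  have w : ∀ (m : SimplexCategoryᵒᵖ) (s : (Λ[n + 1, k] : SSet.{0}).obj m),
      (TopCat.toSSet.map p).app m (h.app m s) = b.app m s.1 := by
    intro m s
    exact ConcreteCategory.congr_hom (congrArg (fun f => NatTrans.app f m) sq.w) s
  let b' : C(stdSimplex ℝ (Fin (n + 2)), B) := TopCat.toSSetObjEquiv B _ (SSet.yonedaEquiv b)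
  -- the value of `h` on the simplices of the horn
  let V : ∀ (S : Finset (Fin (n + 2))) (hS : S.Nonempty) (j : Fin (n + 2)) (hj : j ≠ k)
    (hjS : j ∉ S), C(stdSimplex ℝ (Fin (n + 2)), E) := fun S hS j hj hjS =>
      TopCat.toSSetObjEquiv E _ (h.app _ (hornSimplex k S hS j hj hjS))
  have hV : ∀ (S T : Finset (Fin (n + 2))) (hS : S.Nonempty) (hT : T.Nonempty)
      (hST : S ⊆ T) (j : Fin (n + 2)) (hj : j ≠ k) (hjS : j ∉ S) (hjT : j ∉ T)
      (z : stdSimplex ℝ (Fin (n + 2))),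
      V S hS j hj hjS z = V T hT j hj hjT (stdSimplex.map (finRetract S hS) z) := by
    intro S T hS hT hST j hj hjS hjT z
    dsimp only [V]
    rw [← hornSimplex_map k S T hS hT hST j hj hjS hjT]
    rw [NatTrans.naturality_apply]
    rfl
  have hVp : ∀ (S : Finset (Fin (n + 2))) (hS : S.Nonempty) (j : Fin (n + 2)) (hj : j ≠ k)
      (hjS : j ∉ S) (z : stdSimplex ℝ (Fin (n + 2))),
      p.hom (V S hS j hj hjS z) = b' (stdSimplex.map (finRetract S hS) z) := by
    intro S hS j hj hjS z
    have := w _ (hornSimplex k S hS j hj hjS)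
    have h2 := DFunLike.congr_fun (congrArg (TopCat.toSSetObjEquiv B _) this) z
    refine Eq.trans ?_ (h2.trans ?_)
    · rfl
    · have : (hornSimplex k S hS j hj hjS).1 = (Δ[n + 1] : SSet.{0}).map (simplexRetract S hS).op
        (SSet.yonedaEquiv (𝟙 _)) := by
        apply SSet.stdSimplex.objEquiv.injective
        apply SimplexCategory.Hom.ext
        apply OrderHom.ext
        funext x
        rfl
      rw [this, NatTrans.naturality_apply, ← SSet.yonedaEquiv_comp, Category.id_comp]
      rfl
  obtain ⟨j0, hj0⟩ := exists_ne k
  let F : Fin (n + 2) → C(stdSimplex ℝ (Fin (n + 2)), E) := fun j =>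
    if hj : j ≠ k then V {j}ᶜ ⟨k, by simpa using hj.symm⟩ j hj (by simp)
      else V {j0}ᶜ ⟨k, by simpa using hj0.symm⟩ j0 hj0 (by simp)
  have hF : ∀ j (hj : j ≠ k), F j = V {j}ᶜ ⟨k, by simpa using hj.symm⟩ j hj (by simp) :=
    fun j hj => dif_pos hj
  obtain ⟨l, hl1, hl2⟩ := horn_core k p.hom hp F b' (by
      intro i j hi hj z hzi hzj
      rw [hF i hi, hF j hj]
      have hS : ({i, j}ᶜ : Finset (Fin (n + 2))).Nonempty := ⟨k, by simp [hi.symm, hj.symm]⟩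
      have hz := stdSimplex_map_simplexRetract ({i, j}ᶜ) hS z (by
        intro l hl
        simp only [Finset.mem_compl, not_not, Finset.mem_insert, Finset.mem_singleton] at hl
        rcases hl with rfl | rfl <;> assumption)
      have h1 := hV ({i, j}ᶜ) ({i}ᶜ) hS ⟨k, by simpa using hi.symm⟩
        (by intro x; simp only [Finset.mem_compl, Finset.mem_insert, Finset.mem_singleton]; tauto)
        i hi (by simp) (by simp) z
      have h2 := hV ({i, j}ᶜ) ({j}ᶜ) hS ⟨k, by simpa using hj.symm⟩
        (by intro x; simp only [Finset.mem_compl, Finset.mem_insert, Finset.mem_singleton]; tauto)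
        j hj (by simp) (by simp) z
      rw [hz] at h1 h2
      rw [← h1, ← h2]
      rfl) (by
      intro j hj z hz
      rw [hF j hj]
      refine (hVp _ _ _ _ _ _).trans ?_
      refine congrArg b' (stdSimplex_map_simplexRetract _ _ _ ?_)
      intro i hi
      simp only [Finset.mem_compl, not_not, Finset.mem_singleton] at hi
      rw [hi, hz])
  have key : ∀ j (hj : j ≠ k) (z : stdSimplex ℝ (Fin (n + 2))),
      V {j}ᶜ ⟨k, by simpa using hj.symm⟩ j hj (by simp) z =
        l (stdSimplex.map (finRetract ({j}ᶜ) ⟨k, by simpa using hj.symm⟩) z) := by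
    intro j hj z
    rw [hl2 j hj, hF j hj]
    · exact hV _ _ _ _ (le_refl _) _ _ _ _ _
    · change FunOnFinite.linearMap ℝ ℝ _ z.1 j = 0
      rw [FunOnFinite.linearMap_apply_apply]
      apply Finset.sum_eq_zero
      intro i hi
      rw [Finset.mem_filter] at hi
      have := finRetract_mem ({j}ᶜ) ⟨k, by simpa using hj.symm⟩ i
      rw [hi.2] at this
      simp at this
  refine ⟨⟨⟨SSet.yonedaEquiv.symm ((TopCat.toSSetObjEquiv E (op ⦋n + 1⦌)).symm l), ?_, ?_⟩⟩⟩
  · apply SSet.hom_ext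
    rintro ⟨m⟩
    ext s
    obtain ⟨j, hj, f, rfl⟩ := hornSimplex_cover k s
    change (_ ≫ _ : (Λ[n + 1, k] : SSet.{0}) ⟶ _).app _ _ = _
    rw [NatTrans.naturality_apply]
    refine Eq.trans ?_ (NatTrans.naturality_apply h f.op _).symm
    congr 1
    apply (TopCat.toSSetObjEquiv E _).injective
    ext z
    refine Eq.trans ?_ (key j hj z).symm
    rfl
  · apply SSet.yonedaEquiv.injective
    rw [SSet.yonedaEquiv_comp, Equiv.apply_symm_apply]
    apply (TopCat.toSSetObjEquiv B _).injective
    ext z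
    exact hl1 z

end PartB

section PartC
open CategoryTheory Opposite Simplicial HomotopicalAlgebra
open SSet.modelCategoryQuillen

/-- The path space fibration `Y^I → Y × Y`. -/
def pathEnds (Y : Type) [TopologicalSpace Y] : C(C(unitInterval, Y), Y × Y) :=
  ⟨fun γ => (γ 0, γ 1), by fun_prop⟩

lemma hlp_pathEnds (Y : Type) [TopologicalSpace Y] : HLP (pathEnds Y) := by
  intro A _ G H hG
  have hG1 : ∀ a, (H (a, 0)).1 = G a 0 := fun a => congrArg Prod.fst (hG a)
  have hG2 : ∀ a, (H (a, 0)).2 = G a 1 := fun a => congrArg Prod.snd (hG a)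
  let pr : ℝ → unitInterval := Set.projIcc 0 1 zero_le_one
  have hpr : Continuous pr := continuous_projIcc
  have hpr0 : pr 0 = 0 := Set.projIcc_of_mem zero_le_one (x := 0) (by simp)
  have hpr1 : pr 1 = 1 := Set.projIcc_of_mem zero_le_one (x := 1) (by simp)
  have hprt : ∀ t : unitInterval, pr t = t := fun t => Set.projIcc_val zero_le_one t
  let u : (A × unitInterval) × unitInterval → ℝ := fun z => z.2 * (1 + 2 * z.1.2) - z.1.2
  have hu : Continuous u := by fun_prop
  let φ : (A × unitInterval) × unitInterval → Y := fun z =>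
    if u z ≤ 0 then (H (z.1.1, pr (- u z))).1 else
      if u z ≤ 1 then G z.1.1 (pr (u z)) else (H (z.1.1, pr (u z - 1))).2
  have hφ : Continuous φ := by
    refine Continuous.if_le (by fun_prop) (Continuous.if_le (by fun_prop) (by fun_prop)
      hu continuous_const ?_) hu continuous_const ?_
    · intro z hz
      rw [hz, sub_self, hpr1, hpr0, hG2]
    · intro z hz
      rw [hz, if_pos zero_le_one, neg_zero, hpr0, hG1]
  refine ⟨(ContinuousMap.mk φ hφ).curry, ?_, ?_⟩
  · intro a
    ext s
    change φ ((a, 0), s) = _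
    have : u ((a, 0), s) = s := by simp [u]
    simp only [φ, this]
    split_ifs with h1 h2
    · have : s = 0 := le_antisymm h1 s.2.1
      rw [this]
      simp [hpr0, hG1]
    · rw [hprt]
    · exact absurd s.2.2 h2
  · rintro ⟨a, t⟩
    apply Prod.ext
    · change φ ((a, t), 0) = _
      have : u ((a, t), 0) = - t := by simp [u]
      simp only [φ, this]
      rw [if_pos (by simpa using t.2.1), neg_neg, hprt]
    · change φ ((a, t), 1) = _
      have : u ((a, t), 1) = 1 + t := by simp [u]; ring
      simp only [φ, this]
      have h0 := t.2.1
      rw [if_neg (by linarith)]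
      split_ifs with h
      · have : t = 0 := le_antisymm (by have : (t : ℝ) ≤ 0 := by linarith
                                        exact this) h0
        rw [this]
        simp [hpr1, hG2]
      · rw [add_sub_cancel_left, hprt]

lemma anodyne_toTop_lift {A B : SSet.{0}} (i : A ⟶ B) (hi : SSet.anodyneExtensions i)
    {X Y : TopCat.{0}} (p : X ⟶ Y) (hp : HLP p.hom) : HasLiftingProperty (SSet.toTop.map i) p := by
  rw [sSetTopAdj.hasLiftingProperty_iff]
  have := fibration_toSSet_map p hp
  exact hi _ (by rwa [← HomotopicalAlgebra.fibration_iff])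

theorem anodyne_toTop {A B : SSet.{0}} (i : A ⟶ B) (hi : SSet.anodyneExtensions i) :
    IsHomotopyEquivalence (SSet.toTop.map i).hom := by
  let p1 : SSet.toTop.obj A ⟶ TopCat.of PUnit := TopCat.ofHom (ContinuousMap.const _ PUnit.unit)
  have hp1 : HLP p1.hom := by
    intro Z _ G H _
    exact ⟨⟨fun z => G z.1, by fun_prop⟩, fun x => rfl, fun z => rfl⟩
  have l1 := anodyne_toTop_lift i hi p1 hp1
  have sq1 : CommSq (𝟙 (SSet.toTop.obj A)) (SSet.toTop.map i) p1
    (TopCat.ofHom (ContinuousMap.const _ PUnit.unit)) := ⟨rfl⟩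
  let r := sq1.lift
  have hr : SSet.toTop.map i ≫ r = 𝟙 _ := sq1.fac_left
  let p2 : TopCat.of C(unitInterval, SSet.toTop.obj B) ⟶
    TopCat.of (SSet.toTop.obj B × SSet.toTop.obj B) := TopCat.ofHom (pathEnds _)
  have l2 := anodyne_toTop_lift i hi p2 (hlp_pathEnds _)
  have sq2 : CommSq (TopCat.ofHom (ContinuousMap.curry
      ((SSet.toTop.map i).hom.comp (ContinuousMap.fst (β := unitInterval))))) (SSet.toTop.map i) p2
    (TopCat.ofHom (((r ≫ SSet.toTop.map i).hom).prodMk (ContinuousMap.id _))) := ⟨by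
      ext a
      · have := ConcreteCategory.congr_hom hr a
        exact congrArg (SSet.toTop.map i).hom this.symm
      · rfl⟩
  let K := sq2.lift
  have hK : K ≫ p2 = _ := sq2.fac_right
  refine ⟨r.hom, ?_, ?_⟩
  · have : r.hom.comp (SSet.toTop.map i).hom = ContinuousMap.id _ :=
      congrArg TopCat.Hom.hom hr
    rw [this]
  · refine ⟨⟨⟨fun z => K.hom z.2 z.1, by fun_prop⟩, ?_, ?_⟩⟩
    · intro x
      exact congrArg Prod.fst (ConcreteCategory.congr_hom hK x)
    · intro x
      exact congrArg Prod.snd (ConcreteCategory.congr_hom hK x)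

lemma IsHomotopyEquivalence.congr_left {A B C : Type*} [TopologicalSpace A] [TopologicalSpace B]
    [TopologicalSpace C] {f : C(A, B)} {g : C(B, C)} (hf : IsHomotopyEquivalence f)
    (hgf : IsHomotopyEquivalence (g.comp f)) : IsHomotopyEquivalence g := by
  obtain ⟨f', h1, h2⟩ := hf
  obtain ⟨k, h3, h4⟩ := hgf
  refine ⟨f.comp k, ?_, ?_⟩
  · -- f k g ~ f k g f f' ~ f f' ~ id
    have e1 : ((f.comp k).comp g).Homotopic (((f.comp k).comp g).comp (f.comp f')) := by
      simpa using (ContinuousMap.Homotopic.refl ((f.comp k).comp g)).comp h2.symm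
    have e2 : (((f.comp k).comp g).comp (f.comp f')).Homotopic (f.comp f') := by
      have := ((ContinuousMap.Homotopic.refl f).comp h3).comp (ContinuousMap.Homotopic.refl f')
      simpa [ContinuousMap.comp_assoc] using this
    exact (e1.trans e2).trans h2
  · simpa [ContinuousMap.comp_assoc] using h4

lemma IsHomotopyEquivalence.comp {A B C : Type*} [TopologicalSpace A] [TopologicalSpace B]
    [TopologicalSpace C] {f : C(A, B)} {g : C(B, C)} (hf : IsHomotopyEquivalence f)
    (hg : IsHomotopyEquivalence g) : IsHomotopyEquivalence (g.comp f) := by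
  obtain ⟨f', h1, h2⟩ := hf
  obtain ⟨g', h3, h4⟩ := hg
  refine ⟨f'.comp g', ?_, ?_⟩
  · have := ((ContinuousMap.Homotopic.refl f').comp h3).comp (ContinuousMap.Homotopic.refl f)
    exact (by simpa [ContinuousMap.comp_assoc] using this :
      ((f'.comp g').comp (g.comp f)).Homotopic (f'.comp f)).trans h1
  · have := ((ContinuousMap.Homotopic.refl g).comp h2).comp (ContinuousMap.Homotopic.refl g')
    exact (by simpa [ContinuousMap.comp_assoc] using this :
      ((g.comp f).comp (f'.comp g')).Homotopic (g.comp g')).trans h4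

lemma isHomotopyEquivalence_id {A : Type*} [TopologicalSpace A] :
    IsHomotopyEquivalence (ContinuousMap.id A) :=
  ⟨ContinuousMap.id A, ContinuousMap.Homotopic.refl _, ContinuousMap.Homotopic.refl _⟩

end PartC

section PartD
open CategoryTheory Opposite Simplicial HomotopicalAlgebra MonoidalCategory Limits
open CartesianMonoidalCategory
open SSet.modelCategoryQuillen

namespace SSetAux
open SSet

variable {X₁ X₂ Y₁ Y₂ E B : SSet.{0}}

lemma pp_rlp_mono_aux (p : E ⟶ B) (hp : (MorphismProperty.monomorphisms SSet.{0}).rlp p)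
    (i : X₁ ⟶ Y₁) [Mono i] (m : ℕ)
    (sq₁₂ : (curriedTensor SSet.{0}).PushoutObjObj ∂Δ[m].ι i) :
    HasLiftingProperty sq₁₂.ι p := by
  let sq₁₃ := Functor.PullbackObjObj.ofHasPullback MonoidalClosed.internalHom ∂Δ[m].ι p
  rw [MonoidalClosed.internalHomAdjunction₂.hasLiftingProperty_iff _ sq₁₃]
  suffices (MorphismProperty.monomorphisms _).rlp sq₁₃.π from this _ ‹Mono i›
  rw [rlp_monomorphisms]
  rintro _ _ _ ⟨n⟩
  rw [← MonoidalClosed.internalHomAdjunction₂.hasLiftingProperty_iff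
    (Subcomplex.unionProd.pushoutObjObj.{0} _ _),
    Subcomplex.unionProd.pushoutObjObj_ι]
  exact hp _ (inferInstance : Mono (Subcomplex.unionProd.{0} ∂Δ[m] ∂Δ[n]).ι)

lemma pp_rlp_mono (p : E ⟶ B) (hp : (MorphismProperty.monomorphisms SSet.{0}).rlp p)
    (i : X₁ ⟶ Y₁) [Mono i] (j : X₂ ⟶ Y₂) [Mono j]
    (sq₁₂ : (curriedTensor SSet.{0}).PushoutObjObj i j) :
    HasLiftingProperty sq₁₂.ι p := by
  let sq₁₃ := Functor.PullbackObjObj.ofHasPullback MonoidalClosed.internalHom i p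
  rw [MonoidalClosed.internalHomAdjunction₂.hasLiftingProperty_iff _ sq₁₃]
  suffices (MorphismProperty.monomorphisms _).rlp sq₁₃.π from this _ ‹Mono j›
  rw [rlp_monomorphisms]
  rintro _ _ _ ⟨n⟩
  let sq := Functor.PushoutObjObj.ofHasPushout (curriedTensor SSet.{0}) i ∂Δ[n].ι
  rw [← MonoidalClosed.internalHomAdjunction₂.hasLiftingProperty_iff sq]
  rw [HasLiftingProperty.iff_of_arrow_iso_left
    (show Arrow.mk sq.ι ≅ Arrow.mk sq.flipTensor.ι from
      Arrow.isoMk (Iso.refl _) (β_ _ _))]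
  exact pp_rlp_mono_aux p hp i n _

lemma pp_lift_of (i : X₁ ⟶ Y₁) (j : X₂ ⟶ Y₂) (p : E ⟶ B)
    (hl : HasLiftingProperty
      (Functor.PushoutObjObj.ofHasPushout (curriedTensor SSet.{0}) i j).ι p)
    (a : Y₁ ⊗ X₂ ⟶ E) (c : X₁ ⊗ Y₂ ⟶ E) (b : Y₁ ⊗ Y₂ ⟶ B)
    (w : i ▷ X₂ ≫ a = X₁ ◁ j ≫ c) (wa : a ≫ p = Y₁ ◁ j ≫ b) (wc : c ≫ p = i ▷ Y₂ ≫ b) :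
    ∃ h : Y₁ ⊗ Y₂ ⟶ E, Y₁ ◁ j ≫ h = a ∧ i ▷ Y₂ ≫ h = c ∧ h ≫ p = b := by
  let sq := Functor.PushoutObjObj.ofHasPushout (curriedTensor SSet.{0}) i j
  have e1 : sq.inl ≫ sq.ι = Y₁ ◁ j := sq.inl_ι
  have e2 : sq.inr ≫ sq.ι = i ▷ Y₂ := sq.inr_ι
  let d : sq.pt ⟶ E := sq.isPushout.desc a c w
  have d1 : sq.inl ≫ d = a := sq.isPushout.inl_desc _ _ _
  have d2 : sq.inr ≫ d = c := sq.isPushout.inr_desc _ _ _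
  have csq : CommSq d sq.ι p b := ⟨by
    apply sq.isPushout.hom_ext
    · rw [← Category.assoc, d1, wa, ← Category.assoc, e1]
    · rw [← Category.assoc, d2, wc, ← Category.assoc, e2]⟩
  refine ⟨csq.lift, ?_, ?_, csq.fac_right⟩
  · rw [← e1, Category.assoc, csq.fac_left, d1]
  · rw [← e2, Category.assoc, csq.fac_left, d2]

lemma pp_lift_left (i : X₁ ⟶ Y₁) (j : X₂ ⟶ Y₂) (p : E ⟶ B) [Fibration p]
    (hi : anodyneExtensions i) [Mono j]
    (a : Y₁ ⊗ X₂ ⟶ E) (c : X₁ ⊗ Y₂ ⟶ E) (b : Y₁ ⊗ Y₂ ⟶ B)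
    (w : i ▷ X₂ ≫ a = X₁ ◁ j ≫ c) (wa : a ≫ p = Y₁ ◁ j ≫ b) (wc : c ≫ p = i ▷ Y₂ ≫ b) :
    ∃ h : Y₁ ⊗ Y₂ ⟶ E, Y₁ ◁ j ≫ h = a ∧ i ▷ Y₂ ≫ h = c ∧ h ≫ p = b :=
  pp_lift_of i j p (anodyneExtensions_pushoutObjObjι' _ hi _
    (by rwa [← HomotopicalAlgebra.fibration_iff])) a c b w wa wc

lemma pp_lift_right (i : X₁ ⟶ Y₁) (j : X₂ ⟶ Y₂) (p : E ⟶ B) [Fibration p]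
    (hj : anodyneExtensions j) [Mono i]
    (a : Y₁ ⊗ X₂ ⟶ E) (c : X₁ ⊗ Y₂ ⟶ E) (b : Y₁ ⊗ Y₂ ⟶ B)
    (w : i ▷ X₂ ≫ a = X₁ ◁ j ≫ c) (wa : a ≫ p = Y₁ ◁ j ≫ b) (wc : c ≫ p = i ▷ Y₂ ≫ b) :
    ∃ h : Y₁ ⊗ Y₂ ⟶ E, Y₁ ◁ j ≫ h = a ∧ i ▷ Y₂ ≫ h = c ∧ h ≫ p = b :=
  pp_lift_of i j p (anodyneExtensions_pushoutObjObjι _ hj _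
    (by rwa [← HomotopicalAlgebra.fibration_iff])) a c b w wa wc

/-- The discrete simplicial set with two points. -/
def twoPt : SSet.{0} := (Functor.const _).obj Bool

/-- The inclusion of endpoints. -/
def twoPtι : twoPt ⟶ Δ[1] where
  app n := ↾fun (b : Bool) => SSet.stdSimplex.const 1 (if b then 1 else 0) n
  naturality _ _ _ := rfl

instance : Mono twoPtι := by
  have : ∀ n, Mono (twoPtι.app n) := by
    intro n
    rw [mono_iff_injective]
    intro (a : Bool) (b : Bool) h
    have h2 : (if a then 1 else 0 : Fin 2) = if b then 1 else 0 :=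
      congrArg (fun s => SSet.stdSimplex.asOrderHom s 0) h
    cases a <;> cases b <;> simp at h2 <;> rfl
  exact NatTrans.mono_of_mono_app _

/-- Two maps give a map out of `X ⊗ twoPt`. -/
def twoPtDesc {X E : SSet.{0}} (a₀ a₁ : X ⟶ E) : X ⊗ twoPt ⟶ E where
  app n := ↾fun (z : X.obj n × Bool) => if z.2 then a₁.app n z.1 else a₀.app n z.1
  naturality n m f := by
    ext ⟨x, (b : Bool)⟩
    change (if b then a₁.app m (X.map f x) else a₀.app m (X.map f x)) =
      E.map f (if b then a₁.app n x else a₀.app n x)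
    cases b
    · exact NatTrans.naturality_apply a₀ f x
    · exact NatTrans.naturality_apply a₁ f x

/-- inclusion of first point -/
def twoPtIn (X : SSet.{0}) (b : Bool) : X ⟶ X ⊗ twoPt where
  app n := ↾fun x => (x, b)
  naturality _ _ _ := rfl

lemma twoPt_ext {X E : SSet.{0}} {f g : X ⊗ twoPt ⟶ E}
    (h0 : twoPtIn X false ≫ f = twoPtIn X false ≫ g)
    (h1 : twoPtIn X true ≫ f = twoPtIn X true ≫ g) : f = g := by
  apply SSet.hom_ext
  intro n
  ext ⟨x, b⟩
  cases b
  · exact ConcreteCategory.congr_hom (congrArg (fun f => NatTrans.app f n) h0) x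
  · exact ConcreteCategory.congr_hom (congrArg (fun f => NatTrans.app f n) h1) x

lemma twoPtIn_false_desc {X E : SSet.{0}} (a₀ a₁ : X ⟶ E) :
    twoPtIn X false ≫ twoPtDesc a₀ a₁ = a₀ := rfl
lemma twoPtIn_true_desc {X E : SSet.{0}} (a₀ a₁ : X ⟶ E) :
    twoPtIn X true ≫ twoPtDesc a₀ a₁ = a₁ := rfl
lemma twoPtIn_false_ι (X : SSet.{0}) : twoPtIn X false ≫ X ◁ twoPtι = ι₀ := rfl
lemma twoPtIn_true_ι (X : SSet.{0}) : twoPtIn X true ≫ X ◁ twoPtι = ι₁ := rfl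

lemma htpy_lift (i : X₁ ⟶ Y₁) (p : E ⟶ B)
    (H : HasLiftingProperty
      (Functor.PushoutObjObj.ofHasPushout (curriedTensor SSet.{0}) i twoPtι).ι p)
    (a₀ a₁ : Y₁ ⟶ E) (c : X₁ ⊗ Δ[1] ⟶ E) (b : Y₁ ⊗ Δ[1] ⟶ B)
    (w₀ : i ≫ a₀ = ι₀ ≫ c) (w₁ : i ≫ a₁ = ι₁ ≫ c)
    (wa₀ : a₀ ≫ p = ι₀ ≫ b) (wa₁ : a₁ ≫ p = ι₁ ≫ b) (wc : c ≫ p = i ▷ Δ[1] ≫ b) :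
    ∃ h : Y₁ ⊗ Δ[1] ⟶ E, ι₀ ≫ h = a₀ ∧ ι₁ ≫ h = a₁ ∧ i ▷ Δ[1] ≫ h = c ∧ h ≫ p = b := by
  obtain ⟨h, h1, h2, h3⟩ := pp_lift_of i twoPtι p H (twoPtDesc a₀ a₁) c b
    (twoPt_ext w₀ w₁) (twoPt_ext wa₀ wa₁) wc
  refine ⟨h, ?_, ?_, h2, h3⟩
  · exact congrArg (fun f => twoPtIn Y₁ false ≫ f) h1
  · exact congrArg (fun f => twoPtIn Y₁ true ≫ f) h1

lemma htpy_lift_anodyne (i : X₁ ⟶ Y₁) (p : E ⟶ B) (hi : anodyneExtensions i) [Fibration p]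
    (a₀ a₁ : Y₁ ⟶ E) (c : X₁ ⊗ Δ[1] ⟶ E) (b : Y₁ ⊗ Δ[1] ⟶ B)
    (w₀ : i ≫ a₀ = ι₀ ≫ c) (w₁ : i ≫ a₁ = ι₁ ≫ c)
    (wa₀ : a₀ ≫ p = ι₀ ≫ b) (wa₁ : a₁ ≫ p = ι₁ ≫ b) (wc : c ≫ p = i ▷ Δ[1] ≫ b) :
    ∃ h : Y₁ ⊗ Δ[1] ⟶ E, ι₀ ≫ h = a₀ ∧ ι₁ ≫ h = a₁ ∧ i ▷ Δ[1] ≫ h = c ∧ h ≫ p = b :=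
  htpy_lift i p (anodyneExtensions_pushoutObjObjι' _ hi _
    (by rwa [← HomotopicalAlgebra.fibration_iff])) a₀ a₁ c b w₀ w₁ wa₀ wa₁ wc

lemma htpy_lift_mono (i : X₁ ⟶ Y₁) (p : E ⟶ B) [Mono i]
    (hp : (MorphismProperty.monomorphisms SSet.{0}).rlp p)
    (a₀ a₁ : Y₁ ⟶ E) (c : X₁ ⊗ Δ[1] ⟶ E) (b : Y₁ ⊗ Δ[1] ⟶ B)
    (w₀ : i ≫ a₀ = ι₀ ≫ c) (w₁ : i ≫ a₁ = ι₁ ≫ c)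
    (wa₀ : a₀ ≫ p = ι₀ ≫ b) (wa₁ : a₁ ≫ p = ι₁ ≫ b) (wc : c ≫ p = i ▷ Δ[1] ≫ b) :
    ∃ h : Y₁ ⊗ Δ[1] ⟶ E, ι₀ ≫ h = a₀ ∧ ι₁ ≫ h = a₁ ∧ i ▷ Δ[1] ≫ h = c ∧ h ≫ p = b :=
  htpy_lift i p (pp_rlp_mono p hp i twoPtι _) a₀ a₁ c b w₀ w₁ wa₀ wa₁ wc

/-- The vertex inclusion `Δ[0] ⟶ Δ[1]`. -/
def vtx (e : Fin 2) : (Δ[0] : SSet.{0}) ⟶ Δ[1] := SSet.const (stdSimplex.obj₀Equiv.{0}.symm e)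

lemma fin2_aux : ∀ e j z : Fin 2, j ≠ e → z ≠ j → e = z := by decide

lemma vtx_anodyne (e : Fin 2) : anodyneExtensions (vtx e) := by
  let t : (Λ[1, e] : SSet.{0}) ⟶ Δ[0] := stdSimplex.isTerminalObj₀.from _
  let s : (Δ[0] : SSet.{0}) ⟶ Λ[1, e] := Subcomplex.lift (vtx e) (by
    rintro ⟨m⟩ _ ⟨x, rfl⟩
    induction m using SimplexCategory.rec with | _ m
    rw [mem_horn_iff_notMem_range]
    obtain ⟨j, hj⟩ := exists_ne e
    refine ⟨j, hj, ?_⟩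
    rintro ⟨y, hy⟩
    exact hj hy.symm)
  have hs : s ≫ (Λ[1, e]).ι = vtx e := rfl
  have ht : t ≫ vtx e = (Λ[1, e]).ι := by
    apply SSet.hom_ext
    rintro ⟨m⟩
    ext x
    induction m using SimplexCategory.rec with | _ m
    have hx := x.2
    rw [mem_horn_iff_notMem_range] at hx
    obtain ⟨j, hj, hx⟩ := hx
    apply stdSimplex.objEquiv.injective
    apply SimplexCategory.Hom.ext
    apply OrderHom.ext
    funext y
    change e = (x.1 : Δ[1] _⦋m⦌) y
    have h1 : (x.1 : Δ[1] _⦋m⦌) y ≠ j := fun h => hx ⟨y, h⟩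
    generalize (x.1 : Δ[1] _⦋m⦌) y = z at h1
    exact fin2_aux e j z hj h1
  intro E B p hp
  have := anodyneExtensions.horn_ι e p hp
  constructor
  intro a b sq
  have sq' : CommSq (t ≫ a) (Λ[1, e]).ι p b := ⟨by
    rw [Category.assoc, sq.w, ← Category.assoc, ht]⟩
  refine ⟨⟨sq'.lift, ?_, sq'.fac_right⟩⟩
  rw [← hs, Category.assoc, sq'.fac_left, ← Category.assoc]
  rw [show s ≫ t = 𝟙 _ from stdSimplex.ext₀, Category.id_comp]

instance (e : Fin 2) : Mono (vtx e) := by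
  constructor
  intro Z f g _
  exact stdSimplex.ext₀


lemma hel (e : Fin 2) (ιe : ∀ X : SSet.{0}, X ⟶ X ⊗ Δ[1])
    (hιe : ∀ X, ιe X = CartesianMonoidalCategory.lift (𝟙 X)
      (SSet.const (stdSimplex.obj₀Equiv.{0}.symm e)))
    (i : X₁ ⟶ Y₁) (p : E ⟶ B) [Mono i] [Fibration p]
    (a : Y₁ ⟶ E) (c : X₁ ⊗ Δ[1] ⟶ E) (b : Y₁ ⊗ Δ[1] ⟶ B)
    (w : i ≫ a = ιe _ ≫ c) (wa : a ≫ p = ιe _ ≫ b) (wc : c ≫ p = i ▷ Δ[1] ≫ b) :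
    ∃ h : Y₁ ⊗ Δ[1] ⟶ E, ιe _ ≫ h = a ∧ i ▷ Δ[1] ≫ h = c ∧ h ≫ p = b := by
  obtain rfl : ιe = fun X => CartesianMonoidalCategory.lift (𝟙 X)
      (SSet.const (stdSimplex.obj₀Equiv.{0}.symm e)) := funext hιe
  let z : ∀ X : SSet.{0}, X ⟶ X ⊗ Δ[0] := fun X =>
    CartesianMonoidalCategory.lift (𝟙 X) (stdSimplex.isTerminalObj₀.from X)
  have hz : ∀ X : SSet.{0}, z X ≫ X ◁ vtx e = CartesianMonoidalCategory.lift (𝟙 X)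
      (SSet.const (stdSimplex.obj₀Equiv.{0}.symm e)) := fun X => rfl
  have hz' : ∀ X : SSet.{0}, X ◁ vtx e = fst X Δ[0] ≫ CartesianMonoidalCategory.lift (𝟙 X)
      (SSet.const (stdSimplex.obj₀Equiv.{0}.symm e)) := fun X => rfl
  obtain ⟨h, h1, h2, h3⟩ := pp_lift_right i (vtx e) p (vtx_anodyne e) (fst _ _ ≫ a) c b
    (by rw [hz', Category.assoc, ← w]; rfl) (by rw [hz', Category.assoc, wa]; rfl) wc
  refine ⟨h, ?_, h2, h3⟩
  have := congrArg (fun f => z Y₁ ≫ f) h1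
  exact this

lemma hel₀ (i : X₁ ⟶ Y₁) (p : E ⟶ B) [Mono i] [Fibration p]
    (a : Y₁ ⟶ E) (c : X₁ ⊗ Δ[1] ⟶ E) (b : Y₁ ⊗ Δ[1] ⟶ B)
    (w : i ≫ a = ι₀ ≫ c) (wa : a ≫ p = ι₀ ≫ b) (wc : c ≫ p = i ▷ Δ[1] ≫ b) :
    ∃ h : Y₁ ⊗ Δ[1] ⟶ E, ι₀ ≫ h = a ∧ i ▷ Δ[1] ≫ h = c ∧ h ≫ p = b :=
  hel 0 (fun X => ι₀) (fun X => rfl) i p a c b w wa wc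

lemma hel₁ (i : X₁ ⟶ Y₁) (p : E ⟶ B) [Mono i] [Fibration p]
    (a : Y₁ ⟶ E) (c : X₁ ⊗ Δ[1] ⟶ E) (b : Y₁ ⊗ Δ[1] ⟶ B)
    (w : i ≫ a = ι₁ ≫ c) (wa : a ≫ p = ι₁ ≫ b) (wc : c ≫ p = i ▷ Δ[1] ≫ b) :
    ∃ h : Y₁ ⊗ Δ[1] ⟶ E, ι₁ ≫ h = a ∧ i ▷ Δ[1] ≫ h = c ∧ h ≫ p = b :=
  hel 1 (fun X => ι₁) (fun X => rfl) i p a c b w wa wc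

lemma ιe_anodyne (e : Fin 2) (X : SSet.{0}) : anodyneExtensions
    (CartesianMonoidalCategory.lift (𝟙 X) (SSet.const (stdSimplex.obj₀Equiv.{0}.symm e)) :
      X ⟶ X ⊗ Δ[1]) := by
  intro E B p hp
  have := (vtx_anodyne e).whiskerLeft X p hp
  constructor
  intro a b sq
  have sq' : CommSq (fst X Δ[0] ≫ a) (X ◁ vtx e) p b := ⟨by
    rw [Category.assoc, sq.w]; rfl⟩
  refine ⟨⟨sq'.lift, ?_, sq'.fac_right⟩⟩
  exact congrArg (fun f => CartesianMonoidalCategory.lift (𝟙 X)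
    (stdSimplex.isTerminalObj₀.from X) ≫ f) sq'.fac_left

/-- `ι₀` is anodyne. -/
lemma ι₀_anodyne (X : SSet.{0}) : anodyneExtensions (ι₀ : X ⟶ X ⊗ Δ[1]) := ιe_anodyne 0 X

/-- `ι₁` is anodyne. -/
lemma ι₁_anodyne (X : SSet.{0}) : anodyneExtensions (ι₁ : X ⟶ X ⊗ Δ[1]) := ιe_anodyne 1 X

/-- Cancellation for anodyne extensions. -/
lemma anodyne_cancel {X Y Z : SSet.{0}} (i : X ⟶ Y) (j : Y ⟶ Z) [Mono j]
    (hi : anodyneExtensions i) (hij : anodyneExtensions (i ≫ j)) : anodyneExtensions j := by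
  intro E B p hp
  have hl := hij p hp
  rw [← HomotopicalAlgebra.fibration_iff] at hp
  constructor
  intro u b sq
  have sq1 : CommSq (i ≫ u) (i ≫ j) p b := ⟨by simp [sq.w]⟩
  let w := sq1.lift
  have hw1 : (i ≫ j) ≫ w = i ≫ u := sq1.fac_left
  have hw2 : w ≫ p = b := sq1.fac_right
  obtain ⟨h, h0, h1, h2, h3⟩ := htpy_lift_anodyne i p hi (j ≫ w) u (fst _ _ ≫ i ≫ u)
    (fst _ _ ≫ j ≫ b) (by rw [← Category.assoc, hw1]; rfl) rfl
    (by rw [Category.assoc, hw2]; rfl) sq.w (by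
      rw [Category.assoc, Category.assoc, sq.w]; rfl)
  obtain ⟨k, k0, k1, k2⟩ := hel₀ j p w h (fst _ _ ≫ b) h0.symm hw2 (by rw [h3]; rfl)
  refine ⟨⟨ι₁ ≫ k, ?_, ?_⟩⟩
  · rw [← h1, ← k1]; rfl
  · rw [Category.assoc, k2]; rfl

/-- The point of a contractible simplicial set is anodyne. -/
lemma point_anodyne {K : SSet.{0}} (v : Δ[0] ⟶ K) (h : K ⊗ Δ[1] ⟶ K) (h0 : ι₀ ≫ h = 𝟙 K)
    (h1 : ι₁ ≫ h = stdSimplex.isTerminalObj₀.from K ≫ v) : anodyneExtensions v := by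
  have : Mono v := ⟨fun _ _ _ => stdSimplex.ext₀⟩
  intro E B p hp
  rw [← HomotopicalAlgebra.fibration_iff] at hp
  constructor
  intro e b sq
  have := ι₀_anodyne (Δ[0] : SSet.{0}) p (by rwa [← HomotopicalAlgebra.fibration_iff])
  have sqγ : CommSq e ι₀ p (v ▷ Δ[1] ≫ h ≫ b) := ⟨by
    rw [sq.w]
    conv_lhs => rw [← Category.id_comp b, ← h0]
    rfl⟩
  let γ := sqγ.lift
  have γ0 : ι₀ ≫ γ = e := sqγ.fac_left
  have γ1 : γ ≫ p = v ▷ Δ[1] ≫ h ≫ b := sqγ.fac_right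
  obtain ⟨k, k0, k1, k2⟩ := hel₁ v p (stdSimplex.isTerminalObj₀.from K ≫ ι₁ ≫ γ) γ (h ≫ b)
    (by
      rw [← Category.assoc, show v ≫ stdSimplex.isTerminalObj₀.from K = 𝟙 _ from stdSimplex.ext₀,
        Category.id_comp])
    (by
      rw [Category.assoc, Category.assoc, γ1]
      change _ ≫ _ ≫ _ = (ι₁ ≫ h) ≫ b
      rw [h1, ← Category.assoc ι₁]
      have : (ι₁ ≫ v ▷ Δ[1]) ≫ h ≫ b = v ≫ (ι₁ ≫ h) ≫ b := rfl
      rw [this, h1]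
      simp only [← Category.assoc]
      congr 2)
    γ1
  refine ⟨⟨ι₀ ≫ k, ?_, ?_⟩⟩
  · rw [← γ0, ← k1]; rfl
  · rw [Category.assoc, k2, ← Category.assoc, h0, Category.id_comp]

end SSetAux

end PartD

section PartE
namespace SSetAux
open SSet
open CategoryTheory Opposite Simplicial HomotopicalAlgebra MonoidalCategory Limits
open CartesianMonoidalCategory
open SSet.modelCategoryQuillen

/-- The cofree simplicial set on `Prop` in degree `k`. -/
def cofree (k : SimplexCategory) : SSet.{0} where
  obj n := (k ⟶ n.unop) → Prop
  map f := ↾fun φ θ => φ (θ ≫ f.unop)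
  map_id n := by
    refine ConcreteCategory.hom_ext _ _ fun φ => ?_
    funext θ
    change φ (θ ≫ 𝟙 _) = φ θ
    rw [Category.comp_id]
  map_comp f g := by
    refine ConcreteCategory.hom_ext _ _ fun φ => ?_
    funext θ
    change φ (θ ≫ g.unop ≫ f.unop) = φ ((θ ≫ g.unop) ≫ f.unop)
    rw [Category.assoc]

/-- The map to a cofree simplicial set. -/
def toCofree {X : SSet.{0}} (k : SimplexCategory) (ψ : X.obj (op k) → Prop) : X ⟶ cofree k where
  app n := ↾fun x => fun (θ : k ⟶ n.unop) => ψ (X.map θ.op x)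
  naturality n m f := by
    ext x
    funext θ
    change ψ (X.map θ.op (X.map f x)) = ψ (X.map (θ ≫ f.unop).op x)
    congr 1
    exact (Functor.map_comp_apply X f θ.op x).symm

lemma cofree_app {X : SSet.{0}} {k n : SimplexCategory} (u : X ⟶ cofree k) (x : X.obj (op n))
    (θ : k ⟶ n) : (u.app (op n) x : (k ⟶ n) → Prop) θ =
      (u.app (op k) (X.map θ.op x) : (k ⟶ k) → Prop) (𝟙 _) := by
  have := NatTrans.naturality_apply u θ.op x
  have h2 := congrFun this (𝟙 k)
  refine Eq.trans ?_ h2.symm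
  change _ = (u.app (op n) x : (k ⟶ n) → Prop) (𝟙 _ ≫ θ)
  rw [Category.id_comp]

lemma mono_of_cofree {A B : SSet.{0}} (f : A ⟶ B)
    (H : ∀ (k : SimplexCategory) (u : A ⟶ cofree k), ∃ v : B ⟶ cofree k, f ≫ v = u) :
    Mono f := by
  have : ∀ n, Mono (f.app n) := by
    rintro ⟨n⟩
    rw [CategoryTheory.mono_iff_injective]
    intro a b hab
    obtain ⟨v, hv⟩ := H n (toCofree n (fun x => x = b))
    have key : ∀ z : A.obj (op n), (v.app (op n) (f.app (op n) z) : (n ⟶ n) → Prop) (𝟙 n) =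
        (A.map (𝟙 n).op z = b) := fun z =>
      congrFun (ConcreteCategory.congr_hom (congrArg (fun f => NatTrans.app f (op n)) hv) z) (𝟙 n)
    have ka := key a
    have kb := key b
    rw [hab, kb] at ka
    have e : ∀ z : A.obj (op n), A.map (𝟙 n).op z = z := fun z => Functor.map_id_apply A _ z
    rw [e, e] at ka
    exact ka.mp rfl
  exact NatTrans.mono_of_mono_app _

lemma cofree_rlp (k : SimplexCategory) {A B : SSet.{0}} (i : A ⟶ B) [Mono i] (u : A ⟶ cofree k) :
    ∃ v : B ⟶ cofree k, i ≫ v = u := by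
  refine ⟨toCofree k (fun b => ∃ y : A.obj (op k), i.app _ y = b ∧
    (u.app _ y : (k ⟶ k) → Prop) (𝟙 k)), ?_⟩
  apply SSet.hom_ext
  rintro ⟨n⟩
  ext x
  funext θ
  refine Eq.trans ?_ (cofree_app u x θ).symm
  have hi : Function.Injective (i.app (op k)) := by
    rw [← CategoryTheory.mono_iff_injective]; infer_instance
  refine propext (Iff.intro ?_ ?_)
  · rintro ⟨y, hy, h⟩
    have : y = A.map θ.op x := hi (hy.trans (NatTrans.naturality_apply i θ.op x).symm)
    rwa [this] at h
  · intro h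
    exact ⟨_, NatTrans.naturality_apply i θ.op x, h⟩

lemma mono_of_llp {A B : SSet.{0}} (f : A ⟶ B)
    (hf : (MorphismProperty.monomorphisms SSet.{0}).rlp.llp f) : Mono f := by
  apply mono_of_cofree
  intro k u
  have := hf (stdSimplex.isTerminalObj₀.from (cofree k)) (by
    intro X Y i hi
    have : Mono i := hi
    constructor
    intro a b sq
    obtain ⟨v, hv⟩ := cofree_rlp k i a
    exact ⟨⟨v, hv, stdSimplex.ext₀⟩⟩)
  have sq : CommSq u f (stdSimplex.isTerminalObj₀.from (cofree k))
    (stdSimplex.isTerminalObj₀.from B) := ⟨stdSimplex.ext₀⟩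
  exact ⟨sq.lift, sq.fac_left⟩

/-- Extension of semisimplicial maps to a cofree object along a mono. -/
lemma semi_ext (k : SimplexCategory) {A C : SSet.{0}} (j : A ⟶ C) [Mono j]
    (φ : SemiSSet.f.obj A ⟶ SemiSSet.f.obj (cofree k)) :
    ∃ φ' : SemiSSet.f.obj C ⟶ SemiSSet.f.obj (cofree k), SemiSSet.f.map j ≫ φ' = φ := by
  have hj : ∀ n, Function.Injective (j.app n) := fun n => by
    rw [← CategoryTheory.mono_iff_injective]; infer_instance
  let Φ : ∀ n : SimplexCategory, A.obj (op n) → (k ⟶ n) → Prop := fun n y =>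
    φ.app (op (show SemiSimplexCat from n)) y
  have hΦ : ∀ (n m : SimplexCategory) (i : m ⟶ n) [Mono i] (y : A.obj (op n)) (θ : k ⟶ m),
      Φ m (A.map i.op y) θ = Φ n y (θ ≫ i) := by
    intro n m i hi y θ
    let i' : (show SemiSimplexCat from m) ⟶ (show SemiSimplexCat from n) :=
      ⟨i, SimplexCategory.mono_iff_injective.mp hi⟩
    exact congrFun (NatTrans.naturality_apply φ i'.op y) θ
  let Ψ : ∀ n : SimplexCategory, C.obj (op n) → (k ⟶ n) → Prop := fun n x θ =>
    ∃ (m : SimplexCategory) (s : k ⟶ m) (i : m ⟶ n) (y : A.obj (op m)),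
      StrongEpi s ∧ Mono i ∧ s ≫ i = θ ∧ C.map i.op x = j.app _ y ∧ Φ m y s
  have hΨ : ∀ (n m : SimplexCategory) (i : m ⟶ n) [Mono i] (y : C.obj (op n)) (θ : k ⟶ m),
      Ψ m (C.map i.op y) θ = Ψ n y (θ ≫ i) := by
    intro n m δ hδ x θ
    refine propext (Iff.intro ?_ ?_)
    · rintro ⟨l, s, i, y, hs, hi, e, h, H⟩
      refine ⟨l, s, i ≫ δ, y, hs, mono_comp _ _, by rw [← e, Category.assoc], ?_, H⟩
      rw [← h]
      exact Functor.map_comp_apply C δ.op i.op x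
    · rintro ⟨l, s, i, y, hs, hi, e, h, H⟩
      have sq : CommSq θ s δ i := ⟨e.symm⟩
      have f1 := sq.fac_left
      have f2 := sq.fac_right
      refine ⟨l, s, sq.lift, y, hs, ?_, f1, ?_, H⟩
      · have : Mono (sq.lift ≫ δ) := by rw [f2]; exact hi
        exact mono_of_mono _ δ
      · rw [← h]
        refine (Functor.map_comp_apply C δ.op sq.lift.op x).symm.trans ?_
        rw [← op_comp, f2]
  have hΨΦ : ∀ (n : SimplexCategory) (a : A.obj (op n)) (θ : k ⟶ n),
      Ψ n (j.app (op n) a) θ = Φ n a θ := by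
    intro n a θ
    refine propext (Iff.intro ?_ ?_)
    · rintro ⟨l, s, i, y, hs, hi, e, h, H⟩
      have : A.map i.op a = y := hj _ ((NatTrans.naturality_apply j i.op a).trans h)
      rw [← this, hΦ, e] at H
      exact H
    · intro H
      refine ⟨image θ, factorThruImage θ, image.ι θ, A.map (image.ι θ).op a, inferInstance,
        inferInstance, image.fac θ, (NatTrans.naturality_apply j _ a).symm, ?_⟩
      rw [hΦ, image.fac]
      exact H
  refine ⟨⟨fun n => ↾fun x => Ψ n.unop x, ?_⟩, ?_⟩
  · intro n m δ
    refine ConcreteCategory.hom_ext _ _ fun x => ?_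
    funext θ
    have : Mono δ.unop.1 := SimplexCategory.mono_iff_injective.mpr δ.unop.2
    exact hΨ _ _ δ.unop.1 x θ
  · apply NatTrans.ext
    funext n
    refine ConcreteCategory.hom_ext _ _ fun a => ?_
    funext θ
    exact hΨΦ n.unop a θ

lemma mono_df (adj : SemiSSet.d ⊣ SemiSSet.f) {A C : SSet.{0}} (j : A ⟶ C) [Mono j] :
    Mono (SemiSSet.d.map (SemiSSet.f.map j)) := by
  apply mono_of_cofree
  intro k u
  obtain ⟨v, hv⟩ := semi_ext k j (adj.homEquiv _ _ u)
  refine ⟨(adj.homEquiv _ _).symm v, ?_⟩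
  rw [← adj.homEquiv_naturality_left_symm, hv, Equiv.symm_apply_apply]

end SSetAux

end PartE

section PartF
namespace SSetAux
open SSet
open CategoryTheory Opposite Simplicial HomotopicalAlgebra MonoidalCategory Limits
open CartesianMonoidalCategory
open SSet.modelCategoryQuillen

/-- Successor object. -/
abbrev sc (a : SimplexCategory) : SimplexCategory := SimplexCategory.mk (a.len + 1)

/-- Append the last vertex. -/
def extLast {a : SimplexCategory} {n : ℕ} (x : a ⟶ ⦋n⦌) : sc a ⟶ ⦋n⦌ :=
  SimplexCategory.Hom.mk
    { toFun := Fin.lastCases (Fin.last n) (fun i => x.toOrderHom i)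
      monotone' := by
        intro i j hij
        induction j using Fin.lastCases with
        | last =>
          simp only [Fin.lastCases_last]
          exact Fin.le_last _
        | cast j =>
          induction i using Fin.lastCases with
          | last => exact absurd (lt_of_lt_of_le (Fin.castSucc_lt_last j) hij) (lt_irrefl _)
          | cast i =>
            simp only [Fin.lastCases_castSucc]
            exact x.toOrderHom.monotone (by simpa using hij) }

/-- The cone on a map. -/
def coneMap {a b : SimplexCategory} (x : a ⟶ b) : sc a ⟶ sc b :=
  SimplexCategory.Hom.mk
    { toFun := Fin.lastCases (Fin.last _) (fun i => Fin.castSucc (x.toOrderHom i))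
      monotone' := by
        intro i j hij
        induction j using Fin.lastCases with
        | last =>
          simp only [Fin.lastCases_last]
          exact Fin.le_last _
        | cast j =>
          induction i using Fin.lastCases with
          | last => exact absurd (lt_of_lt_of_le (Fin.castSucc_lt_last j) hij) (lt_irrefl _)
          | cast i =>
            simp only [Fin.lastCases_castSucc]
            exact Fin.castSucc_le_castSucc_iff.mpr (x.toOrderHom.monotone (by simpa using hij)) }

lemma coneMap_injective {a b : SimplexCategory} (x : a ⟶ b)
    (hx : Function.Injective x.toOrderHom) : Function.Injective (coneMap x).toOrderHom := by
  intro i j hij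
  change (Fin.lastCases (Fin.last _) (fun i => Fin.castSucc (x.toOrderHom i)) i : Fin (b.len+2)) =
    Fin.lastCases (Fin.last _) (fun i => Fin.castSucc (x.toOrderHom i)) j at hij
  induction j using Fin.lastCases with
  | last =>
    induction i using Fin.lastCases with
    | last => rfl
    | cast i => simp [Fin.castSucc_ne_last] at hij
  | cast j =>
    induction i using Fin.lastCases with
    | last => simp [(Fin.castSucc_ne_last _).symm] at hij
    | cast i =>
      simp only [Fin.lastCases_castSucc] at hij
      rw [hx (Fin.castSucc_injective _ hij)]

/-- The prism map. -/
def prism {k a : SimplexCategory} (x : k ⟶ a) (t : k ⟶ ⦋1⦌) : k ⟶ sc a :=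
  SimplexCategory.Hom.mk
    { toFun := fun i => if t.toOrderHom i = 0 then Fin.castSucc (x.toOrderHom i) else Fin.last _
      monotone' := by
        intro i j hij
        have h1 := t.toOrderHom.monotone hij
        have h2 := x.toOrderHom.monotone hij
        dsimp only
        split_ifs with h h' h'
        · exact Fin.castSucc_le_castSucc_iff.mpr h2
        · exact Fin.le_last _
        · rw [h'] at h1
          exact absurd (le_antisymm h1 (Fin.zero_le _)) h
        · exact le_rfl }

lemma hom_ext' {a b : SimplexCategory} {f g : a ⟶ b}
    (h : ∀ i, f.toOrderHom i = g.toOrderHom i) : f = g := by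
  apply SimplexCategory.Hom.ext
  exact OrderHom.ext _ _ (funext h)

lemma prism_comp {l k a : SimplexCategory} (θ : l ⟶ k) (x : k ⟶ a) (t : k ⟶ ⦋1⦌) :
    θ ≫ prism x t = prism (θ ≫ x) (θ ≫ t) := rfl

lemma prism_coneMap {k a b : SimplexCategory} (x : k ⟶ a) (t : k ⟶ ⦋1⦌) (δ : a ⟶ b) :
    prism x t ≫ coneMap δ = prism (x ≫ δ) t := by
  apply hom_ext'
  intro i
  change (Fin.lastCases (Fin.last _) (fun i => Fin.castSucc (δ.toOrderHom i))
    (if t.toOrderHom i = 0 then Fin.castSucc (x.toOrderHom i) else Fin.last _) : Fin (b.len+2)) =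
    if t.toOrderHom i = 0 then Fin.castSucc (δ.toOrderHom (x.toOrderHom i)) else Fin.last _
  split_ifs <;> simp

lemma coneMap_extLast {a b : SimplexCategory} {n : ℕ} (δ : a ⟶ b) (x : b ⟶ ⦋n⦌) :
    coneMap δ ≫ extLast x = extLast (δ ≫ x) := by
  apply hom_ext'
  intro i
  change (Fin.lastCases (Fin.last n) (fun i => x.toOrderHom i)
    (Fin.lastCases (Fin.last _) (fun i => Fin.castSucc (δ.toOrderHom i)) i : Fin (b.len+2)) :
      Fin (n+1)) = Fin.lastCases (Fin.last n) (fun i => x.toOrderHom (δ.toOrderHom i)) i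
  induction i using Fin.lastCases <;> simp

/-- Inclusion -/
def inSc (a : SimplexCategory) : a ⟶ sc a :=
  SimplexCategory.Hom.mk ⟨Fin.castSucc, fun _ _ h => Fin.castSucc_le_castSucc_iff.mpr h⟩

lemma inSc_injective (a : SimplexCategory) : Function.Injective (inSc a).toOrderHom :=
  Fin.castSucc_injective _

/-- Last vertex -/
def lastV (a : SimplexCategory) : ⦋0⦌ ⟶ a :=
  SimplexCategory.Hom.mk ⟨fun _ => Fin.last _, fun _ _ _ => le_rfl⟩

lemma lastV_injective (a : SimplexCategory) : Function.Injective (lastV a).toOrderHom :=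
  fun _ _ _ => Subsingleton.elim (α := Fin 1) _ _

/-- collapse -/
def toZ (a : SimplexCategory) : a ⟶ ⦋0⦌ :=
  SimplexCategory.Hom.mk ⟨fun _ => 0, fun _ _ _ => le_rfl⟩

/-- constant -/
def cst (a : SimplexCategory) (e : Fin 2) : a ⟶ ⦋1⦌ :=
  SimplexCategory.Hom.mk ⟨fun _ => e, fun _ _ _ => le_rfl⟩

lemma prism_zero {k a : SimplexCategory} (x : k ⟶ a) : prism x (cst k 0) = x ≫ inSc a := rfl
lemma prism_one {k a : SimplexCategory} (x : k ⟶ a) :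
    prism x (cst k 1) = toZ k ≫ lastV (sc a) := rfl

lemma inSc_extLast {a : SimplexCategory} {n : ℕ} (x : a ⟶ ⦋n⦌) : inSc a ≫ extLast x = x := by
  apply hom_ext'
  intro i
  change (Fin.lastCases (Fin.last n) (fun i => x.toOrderHom i) (Fin.castSucc i) : Fin (n+1)) = _
  simp

lemma lastV_extLast {a : SimplexCategory} {n : ℕ} (x : a ⟶ ⦋n⦌) :
    lastV (sc a) ≫ extLast x = lastV ⦋n⦌ := by
  apply hom_ext'
  intro i
  change (Fin.lastCases (Fin.last n) (fun i => x.toOrderHom i) (Fin.last _) : Fin (n+1)) = _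
  simp
  rfl

/-- The simplex of the standard simplex attached to a morphism. -/
abbrev sx {a : SimplexCategory} {n : ℕ} (x : a ⟶ ⦋n⦌) : (Δ[n] : SSet.{0}).obj (op a) :=
  stdSimplex.objEquiv.symm x

/-- The morphism attached to a simplex. -/
abbrev un {a : SimplexCategory} {n : ℕ} (x : (Δ[n] : SSet.{0}).obj (op a)) : a ⟶ ⦋n⦌ :=
  stdSimplex.objEquiv x

lemma map_sx {a b : SimplexCategory} {n : ℕ} (θ : b ⟶ a) (x : a ⟶ ⦋n⦌) :
    (Δ[n] : SSet.{0}).map θ.op (sx x) = sx (θ ≫ x) := rfl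
lemma un_map {a b : SimplexCategory} {n : ℕ} (θ : b ⟶ a) (x : (Δ[n] : SSet.{0}).obj (op a)) :
    un ((Δ[n] : SSet.{0}).map θ.op x) = θ ≫ un x := rfl

/-- The path object. -/
def PObj (K : SSet.{0}) : SSet.{0} where
  obj m := stdSimplex.obj m.unop ⊗ Δ[1] ⟶ K
  map f := ↾fun γ => SSet.stdSimplex.map f.unop ▷ Δ[1] ≫ γ
  map_id m := by
    refine ConcreteCategory.hom_ext _ _ fun γ => ?_
    change SSet.stdSimplex.map (𝟙 m).unop ▷ Δ[1] ≫ γ = γ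
    refine Eq.trans (congrArg (fun h => h ▷ Δ[1] ≫ γ)
      (CategoryTheory.Functor.map_id SSet.stdSimplex m.unop)) ?_
    exact (congrArg (fun h => h ≫ γ) (id_whiskerRight _ _)).trans (Category.id_comp _)
  map_comp f g := by
    refine ConcreteCategory.hom_ext _ _ fun γ => ?_
    change SSet.stdSimplex.map (f ≫ g).unop ▷ Δ[1] ≫ γ =
      SSet.stdSimplex.map g.unop ▷ Δ[1] ≫ SSet.stdSimplex.map f.unop ▷ Δ[1] ≫ γ
    rfl

/-- Uncurrying. -/
def uncurryP {X K : SSet.{0}} (H : X ⟶ PObj K) : X ⊗ Δ[1] ⟶ K where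
  app m := ↾fun z => (H.app m z.1 : stdSimplex.obj m.unop ⊗ Δ[1] ⟶ K).app m
    (stdSimplex.objEquiv.symm (𝟙 m.unop), z.2)
  naturality m l θ := by
    refine ConcreteCategory.hom_ext _ _ fun z => ?_
    have h1 := NatTrans.naturality_apply H θ z.1
    have h2 := NatTrans.naturality_apply (H.app m z.1 : stdSimplex.obj m.unop ⊗ Δ[1] ⟶ K) θ
      (show (SSet.stdSimplex.obj m.unop ⊗ Δ[1]).obj m from
        (stdSimplex.objEquiv.symm (𝟙 m.unop), z.2))
    have h3 := congrArg (fun γ : stdSimplex.obj l.unop ⊗ Δ[1] ⟶ K => γ.app l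
      (stdSimplex.objEquiv.symm (𝟙 l.unop), (Δ[1] : SSet.{0}).map θ z.2)) h1
    refine Eq.trans h3 (Eq.trans ?_ h2)
    rfl

/-- contraction of the standard simplex -/
def stdContr (n : ℕ) : (Δ[n] : SSet.{0}) ⊗ Δ[1] ⟶ Δ[n] where
  app m := ↾fun z => sx (prism (un z.1) (un z.2) ≫ extLast (𝟙 ⦋n⦌))
  naturality m l θ := rfl

/-- The last vertex as a map -/
def lastPt (n : ℕ) : (Δ[0] : SSet.{0}) ⟶ Δ[n] := SSet.stdSimplex.map (lastV ⦋n⦌)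

lemma lastPt_anodyne (n : ℕ) : anodyneExtensions (lastPt n) := by
  refine point_anodyne _ (stdContr n) ?_ ?_
  · apply SSet.hom_ext
    rintro ⟨m⟩
    ext x
    apply stdSimplex.objEquiv.injective
    change prism (un x) (cst m 0) ≫ extLast (𝟙 ⦋n⦌) = un x
    rw [prism_zero, Category.assoc, inSc_extLast, Category.comp_id]
  · apply SSet.hom_ext
    rintro ⟨m⟩
    ext x
    apply stdSimplex.objEquiv.injective
    change prism (un x) (cst m 1) ≫ extLast (𝟙 ⦋n⦌) = toZ m ≫ lastV ⦋n⦌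
    rw [prism_one, Category.assoc, lastV_extLast]

variable (adj : SemiSSet.d ⊣ SemiSSet.f)

/-- unit at simplices -/
def etaS (X : SSet.{0}) (a : SimplexCategory) (x : X.obj (op a)) :
    (SemiSSet.d.obj (SemiSSet.f.obj X)).obj (op a) :=
  (adj.unit.app (SemiSSet.f.obj X)).app (op (show SemiSimplexCat from a)) x

lemma etaS_map {X : SSet.{0}} {a b : SimplexCategory} (δ : b ⟶ a)
    (hδ : Function.Injective δ.toOrderHom) (x : X.obj (op a)) :
    etaS adj X b (X.map δ.op x) = (SemiSSet.d.obj (SemiSSet.f.obj X)).map δ.op (etaS adj X a x) :=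
  NatTrans.naturality_apply (adj.unit.app (SemiSSet.f.obj X))
    (Quiver.Hom.op (show (show SemiSimplexCat from b) ⟶ (show SemiSimplexCat from a) from ⟨δ, hδ⟩)) x

lemma d_hom_ext {X K : SSet.{0}} {u v : SemiSSet.d.obj (SemiSSet.f.obj X) ⟶ K}
    (h : ∀ (a : SimplexCategory) (x : X.obj (op a)),
      u.app (op a) (etaS adj X a x) = v.app (op a) (etaS adj X a x)) : u = v := by
  apply (adj.homEquiv _ _).injective
  rw [adj.homEquiv_unit, adj.homEquiv_unit]
  apply NatTrans.ext
  funext a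
  refine ConcreteCategory.hom_ext _ _ fun x => ?_
  exact h a.unop x

lemma d_desc {X K : SSet.{0}} (φ : SemiSSet.f.obj X ⟶ SemiSSet.f.obj K) :
    ∃ u : SemiSSet.d.obj (SemiSSet.f.obj X) ⟶ K, ∀ (a : SimplexCategory) (x : X.obj (op a)),
      u.app (op a) (etaS adj X a x) = φ.app (op (show SemiSimplexCat from a)) x := by
  refine ⟨(adj.homEquiv _ _).symm φ, fun a x => ?_⟩
  have := (adj.homEquiv _ _).apply_symm_apply φ
  rw [adj.homEquiv_unit] at this
  exact ConcreteCategory.congr_hom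
    (congrArg (fun f => NatTrans.app f (op (show SemiSimplexCat from a))) this) x

/-- the cone on a simplex -/
noncomputable def dConeS (n : ℕ) (a : SimplexCategory) (x : a ⟶ ⦋n⦌) :
    SSet.stdSimplex.obj a ⊗ Δ[1] ⟶ SemiSSet.d.obj (SemiSSet.f.obj Δ[n]) where
  app k := ↾fun z => (SemiSSet.d.obj (SemiSSet.f.obj Δ[n])).map
    (prism (stdSimplex.objEquiv z.1) (un z.2)).op (etaS adj Δ[n] (sc a) (sx (extLast x)))
  naturality k l θ := by
    refine ConcreteCategory.hom_ext _ _ fun z => ?_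
    exact Functor.map_comp_apply (SemiSSet.d.obj (SemiSSet.f.obj Δ[n]))
      (prism (stdSimplex.objEquiv z.1) (un z.2)).op θ _

lemma dConeS_comp (n : ℕ) {a b : SimplexCategory} (δ : b ⟶ a)
    (hδ : Function.Injective δ.toOrderHom) (x : a ⟶ ⦋n⦌) :
    dConeS adj n b (δ ≫ x) = SSet.stdSimplex.map δ ▷ Δ[1] ≫ dConeS adj n a x := by
  apply SSet.hom_ext
  rintro ⟨k⟩
  refine ConcreteCategory.hom_ext _ _ fun z => ?_
  change (SemiSSet.d.obj (SemiSSet.f.obj Δ[n])).map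
    (prism (stdSimplex.objEquiv z.1) (un z.2)).op
      (etaS adj Δ[n] (sc b) (sx (extLast (δ ≫ x)))) =
    (SemiSSet.d.obj (SemiSSet.f.obj Δ[n])).map
      (prism (stdSimplex.objEquiv z.1 ≫ δ) (un z.2)).op (etaS adj Δ[n] (sc a) (sx (extLast x)))
  rw [← prism_coneMap, op_comp, Functor.map_comp_apply, ← etaS_map adj _ (coneMap_injective δ hδ),
    map_sx, coneMap_extLast]

/-- the cone family -/
noncomputable def dCone (n : ℕ) : SemiSSet.f.obj Δ[n] ⟶
    SemiSSet.f.obj (PObj (SemiSSet.d.obj (SemiSSet.f.obj Δ[n]))) where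
  app a := ↾fun x => dConeS adj n (show SimplexCategory from a.unop)
    (un (a := show SimplexCategory from a.unop) x)
  naturality a b δ := by
    refine ConcreteCategory.hom_ext _ _ fun x => ?_
    exact dConeS_comp adj n δ.unop.1 δ.unop.2 (un (a := show SimplexCategory from a.unop) x)

/-- The point of `DΔ[n]`. -/
noncomputable def dPt (n : ℕ) : (Δ[0] : SSet.{0}) ⟶ SemiSSet.d.obj (SemiSSet.f.obj Δ[n]) :=
  SSet.yonedaEquiv.symm (etaS adj Δ[n] ⦋0⦌ (sx (lastV ⦋n⦌)))

lemma dPt_app (n : ℕ) (m : SimplexCategory) (z : (Δ[0] : SSet.{0}).obj (op m)) :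
    (dPt adj n).app (op m) z = (SemiSSet.d.obj (SemiSSet.f.obj Δ[n])).map (toZ m).op
      (etaS adj Δ[n] ⦋0⦌ (sx (lastV ⦋n⦌))) := by
  have : z = sx (toZ m) := stdSimplex.objEquiv.injective (Subsingleton.elim _ _)
  rw [this]
  rfl

lemma dPt_anodyne (n : ℕ) : anodyneExtensions (dPt adj n) := by
  obtain ⟨H, hH⟩ := d_desc adj (dCone adj n)
  refine point_anodyne _ (uncurryP H) ?_ ?_
  · apply d_hom_ext adj
    intro a x
    have h1 := congrArg (fun γ : stdSimplex.obj a ⊗ Δ[1] ⟶ _ => γ.app (op a)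
      (stdSimplex.objEquiv.symm (𝟙 a), sx (cst a 0))) (hH a x)
    refine Eq.trans h1 ?_
    change (SemiSSet.d.obj (SemiSSet.f.obj Δ[n])).map (prism (𝟙 a) (cst a 0)).op
      (etaS adj Δ[n] (sc a) (sx (extLast (un x)))) = etaS adj Δ[n] a x
    rw [prism_zero, Category.id_comp, ← etaS_map adj _ (inSc_injective a), map_sx, inSc_extLast]
    rfl
  · apply d_hom_ext adj
    intro a x
    have h1 := congrArg (fun γ : stdSimplex.obj a ⊗ Δ[1] ⟶ _ => γ.app (op a)
      (stdSimplex.objEquiv.symm (𝟙 a), sx (cst a 1))) (hH a x)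
    refine Eq.trans h1 ?_
    refine Eq.trans ?_ (dPt_app adj n a _).symm
    change (SemiSSet.d.obj (SemiSSet.f.obj Δ[n])).map (prism (𝟙 a) (cst a 1)).op
      (etaS adj Δ[n] (sc a) (sx (extLast (un x)))) = _
    rw [prism_one, op_comp, Functor.map_comp_apply,
      ← etaS_map adj _ (lastV_injective (sc a)), map_sx, lastV_extLast]

lemma counit_eta (X : SSet.{0}) (a : SimplexCategory) (x : X.obj (op a)) :
    (adj.counit.app X).app (op a) (etaS adj X a x) = x :=
  ConcreteCategory.congr_hom (congrArg (fun f => NatTrans.app f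
    (op (show SemiSimplexCat from a))) (adj.right_triangle_components X)) x

lemma dPt_counit (n : ℕ) : dPt adj n ≫ adj.counit.app Δ[n] = lastPt n := by
  apply SSet.yonedaEquiv.injective
  rw [SSet.yonedaEquiv_comp]
  have : SSet.yonedaEquiv (dPt adj n) = etaS adj Δ[n] ⦋0⦌ (sx (lastV ⦋n⦌)) :=
    Equiv.apply_symm_apply _ _
  rw [this]
  exact (counit_eta adj _ _ _).trans rfl

end SSetAux

end PartF

section PartG
namespace SSetAux
open SSet
open CategoryTheory Opposite Simplicial HomotopicalAlgebra MonoidalCategory Limits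
open CartesianMonoidalCategory
open SSet.modelCategoryQuillen

section abstractPart

/-- The relative extension property. -/
def Ext {C : Type 1} [Category.{0} C] {D M : C ⥤ C} (i : D ⟶ M) {A X E B : C} (f : A ⟶ X)
    (p : E ⟶ B) : Prop :=
  ∀ (u : D.obj X ⟶ E) (c : M.obj A ⟶ E) (b : M.obj X ⟶ B), i.app A ≫ c = D.map f ≫ u →
    u ≫ p = i.app X ≫ b → c ≫ p = M.map f ≫ b →
    ∃ h : M.obj X ⟶ E, i.app X ≫ h = u ∧ M.map f ≫ h = c ∧ h ≫ p = b

variable {C : Type 1} [Category.{0} C] [HasPullbacks C] [HasPushouts C]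
  {D M D' M' : C ⥤ C} (i : D ⟶ M)

/-- The conjugate transformation. -/
def conj (aD : D ⊣ D') (aM : M ⊣ M') : M' ⟶ D' where
  app E := aD.homEquiv _ _ (i.app _ ≫ aM.counit.app E)
  naturality E B p := by
    rw [← aD.homEquiv_naturality_right, ← aD.homEquiv_naturality_left]
    simp

lemma comp_conj (aD : D ⊣ D') (aM : M ⊣ M') {X E : C} (h : M.obj X ⟶ E) :
    aM.homEquiv _ _ h ≫ (conj i aD aM).app E = aD.homEquiv _ _ (i.app X ≫ h) := by
  simp only [conj]
  rw [← aD.homEquiv_naturality_left]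
  congr 1
  rw [i.naturality_assoc]
  simp [Adjunction.homEquiv_unit]

lemma ext_iff (aD : D ⊣ D') (aM : M ⊣ M') {E B : C} (p : E ⟶ B) :
    ∃ (Q R : C) (q : Q ⟶ R), ∀ {A X : C} (f : A ⟶ X), Ext i f p ↔ HasLiftingProperty f q := by
  refine ⟨M'.obj E, pullback ((conj i aD aM).app B) (D'.map p),
    pullback.lift (M'.map p) ((conj i aD aM).app E) ((conj i aD aM).naturality p), ?_⟩
  intro A X f
  constructor
  · intro H
    constructor
    intro c' r sq
    have hr1 : r ≫ pullback.fst _ _ ≫ (conj i aD aM).app B = r ≫ pullback.snd _ _ ≫ D'.map p := by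
      rw [pullback.condition]
    have s1 : c' ≫ M'.map p = f ≫ r ≫ pullback.fst _ _ := by
      have := sq.w =≫ pullback.fst _ _; rwa [Category.assoc, Category.assoc, pullback.lift_fst] at this
    have s2 : c' ≫ (conj i aD aM).app E = f ≫ r ≫ pullback.snd _ _ := by
      have := sq.w =≫ pullback.snd _ _; rwa [Category.assoc, Category.assoc, pullback.lift_snd] at this
    obtain ⟨c, rfl⟩ := (aM.homEquiv _ _).surjective c'
    obtain ⟨b, hb⟩ := (aM.homEquiv _ _).surjective (r ≫ pullback.fst _ _)
    obtain ⟨u, hu⟩ := (aD.homEquiv _ _).surjective (r ≫ pullback.snd _ _)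
    rw [← reassoc_of% hb, ← reassoc_of% hu] at hr1 
    rw [← hb] at s1
    rw [← hu] at s2
    rw [comp_conj, ← aD.homEquiv_naturality_right] at hr1
    rw [← aM.homEquiv_naturality_left, ← aM.homEquiv_naturality_right] at s1
    rw [comp_conj, ← aD.homEquiv_naturality_left] at s2
    obtain ⟨h, h1, h2, h3⟩ := H u c b ((aD.homEquiv _ _).injective s2)
      ((aD.homEquiv _ _).injective hr1).symm ((aM.homEquiv _ _).injective s1)
    refine ⟨⟨⟨aM.homEquiv _ _ h, ?_, ?_⟩⟩⟩
    · rw [← aM.homEquiv_naturality_left, h2]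
    · apply pullback.hom_ext
      · simp only [Category.assoc, pullback.lift_fst]
        rw [← aM.homEquiv_naturality_right, h3, hb]
      · simp only [Category.assoc, pullback.lift_snd]
        rw [comp_conj, h1, hu]
  · intro H u c b w1 w2 w3
    have sq : CommSq (aM.homEquiv _ _ c) f (pullback.lift (M'.map p) ((conj i aD aM).app E)
        ((conj i aD aM).naturality p)) (pullback.lift (aM.homEquiv _ _ b) (aD.homEquiv _ _ u)
          (by rw [comp_conj, ← aD.homEquiv_naturality_right, w2])) := by
      constructor
      apply pullback.hom_ext
      · simp only [Category.assoc, pullback.lift_fst]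
        rw [← aM.homEquiv_naturality_left, ← aM.homEquiv_naturality_right, w3]
      · simp only [Category.assoc, pullback.lift_snd]
        rw [comp_conj, ← aD.homEquiv_naturality_left, w1]
    obtain ⟨h, hh⟩ := (aM.homEquiv _ _).surjective sq.lift
    have l1 := sq.fac_left
    have l2 := sq.fac_right =≫ pullback.fst _ _
    have l3 := sq.fac_right =≫ pullback.snd _ _
    simp only [Category.assoc, pullback.lift_fst, pullback.lift_snd] at l2 l3
    rw [← hh] at l1 l2 l3
    rw [← aM.homEquiv_naturality_left] at l1
    rw [← aM.homEquiv_naturality_right] at l2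
    rw [comp_conj] at l3
    exact ⟨h, (aD.homEquiv _ _).injective l3, (aM.homEquiv _ _).injective l1,
      (aM.homEquiv _ _).injective l2⟩

/-- The Leibniz map. -/
noncomputable def leib {A X : C} (f : A ⟶ X) :
    pushout (D.map f) (i.app A) ⟶ M.obj X :=
  pushout.desc (i.app X) (M.map f) (i.naturality f)

lemma inl_leib {A X : C} (f : A ⟶ X) : pushout.inl _ _ ≫ leib i f = i.app X :=
  pushout.inl_desc _ _ _

lemma inr_leib {A X : C} (f : A ⟶ X) : pushout.inr _ _ ≫ leib i f = M.map f :=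
  pushout.inr_desc _ _ _

lemma ext_iff_leib {A X E B : C} (f : A ⟶ X) (p : E ⟶ B) :
    Ext i f p ↔ HasLiftingProperty (leib i f) p := by
  constructor
  · intro H
    constructor
    intro t b sq
    have s1 := pushout.inl _ _ ≫= sq.w
    have s2 := pushout.inr _ _ ≫= sq.w
    simp only [leib, pushout.inl_desc_assoc, pushout.inr_desc_assoc] at s1 s2
    obtain ⟨h, h1, h2, h3⟩ := H (pushout.inl _ _ ≫ t) (pushout.inr _ _ ≫ t) b
      (by rw [pushout.condition_assoc]) (by simpa using s1) (by simpa using s2)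
    refine ⟨⟨⟨h, ?_, h3⟩⟩⟩
    apply pushout.hom_ext
    · rw [leib, pushout.inl_desc_assoc, h1]
    · rw [leib, pushout.inr_desc_assoc, h2]
  · intro H u c b w1 w2 w3
    have sq : CommSq (pushout.desc u c w1.symm) (leib i f) p b := by
      constructor
      apply pushout.hom_ext
      · rw [leib, pushout.inl_desc_assoc, pushout.inl_desc_assoc, w2]
      · rw [leib, pushout.inr_desc_assoc, pushout.inr_desc_assoc, w3]
    refine ⟨sq.lift, ?_, ?_, sq.fac_right⟩
    · have := pushout.inl _ _ ≫= sq.fac_left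
      rwa [← Category.assoc, inl_leib, pushout.inl_desc] at this
    · have := pushout.inr _ _ ≫= sq.fac_left
      rwa [← Category.assoc, inr_leib, pushout.inr_desc] at this

lemma ext_iff_initial (aD : D ⊣ D') (aM : M ⊣ M') {A X E B : C} (hA : IsInitial A) (f : A ⟶ X)
    (p : E ⟶ B) : Ext i f p ↔ HasLiftingProperty (i.app X) p := by
  have : D.IsLeftAdjoint := ⟨_, ⟨aD⟩⟩
  have : M.IsLeftAdjoint := ⟨_, ⟨aM⟩⟩
  have hD : IsInitial (D.obj A) := IsInitial.isInitialObj D A hA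
  have hM : IsInitial (M.obj A) := IsInitial.isInitialObj M A hA
  constructor
  · intro H
    constructor
    intro u b sq
    obtain ⟨h, h1, -, h3⟩ := H u (hM.to _) b (hD.hom_ext _ _) sq.w (hM.hom_ext _ _)
    exact ⟨⟨⟨h, h1, h3⟩⟩⟩
  · intro H u c b w1 w2 w3
    have sq : CommSq u (i.app X) p b := ⟨w2⟩
    exact ⟨sq.lift, sq.fac_left, hM.hom_ext _ _, sq.fac_right⟩

end abstractPart

end SSetAux

end PartG

section PartH
namespace SSetAux
open SSet
open CategoryTheory Opposite Simplicial HomotopicalAlgebra MonoidalCategory Limits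
open CartesianMonoidalCategory
open SSet.modelCategoryQuillen

/-- The functor `D`. -/
noncomputable abbrev DD : SSet.{0} ⥤ SSet.{0} := SemiSSet.f ⋙ SemiSSet.d

instance : SemiSSet.f.IsLeftAdjoint := ⟨_, ⟨SemiSimplexCat.ι.op.ranAdjunction (Type)⟩⟩
instance : SemiSSet.d.IsLeftAdjoint := ⟨_, ⟨SemiSimplexCat.ι.op.lanAdjunction (Type)⟩⟩
instance : (tensorRight (Δ[1] : SSet.{0})).IsLeftAdjoint :=
  Functor.isLeftAdjoint_of_iso (BraidedCategory.tensorLeftIsoTensorRight (Δ[1] : SSet.{0}))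

/-- End inclusion. -/
noncomputable def alpha₀ : DD ⟶ DD ⋙ tensorRight (Δ[1] : SSet.{0}) where
  app X := ι₀
  naturality X Y f := rfl
/-- End inclusion. -/
noncomputable def alpha₁ : DD ⟶ DD ⋙ tensorRight (Δ[1] : SSet.{0}) where
  app X := ι₁
  naturality X Y f := rfl

variable (adj : SemiSSet.d ⊣ SemiSSet.f)

/-- The mapping cylinder functor. -/
noncomputable def MM : SSet.{0} ⥤ SSet.{0} := pushout alpha₁ adj.counit

instance spanpres : PreservesColimitsOfSize.{0,0} (span alpha₁ adj.counit).flip := 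
  ⟨fun {J} _ => ⟨fun {F} => ⟨fun {c} hc => ⟨evaluationJointlyReflectsColimits _ (fun k => by
    have : PreservesColimitsOfSize.{0,0} ((span alpha₁ adj.counit).obj k) := by
      rcases k with _ | _ | _
      · exact (inferInstance : PreservesColimitsOfSize.{0,0} DD)
      · exact (inferInstance : PreservesColimitsOfSize.{0,0} (DD ⋙ tensorRight (Δ[1] : SSet.{0})))
      · exact (inferInstance : PreservesColimitsOfSize.{0,0} (𝟭 SSet.{0}))
    exact isColimitOfPreserves ((span alpha₁ adj.counit).obj k) hc)⟩⟩⟩⟩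

instance : PreservesColimitsOfSize.{0,0} (MM adj) := 
  preservesColimits_of_natIso (colimitIsoFlipCompColim (span alpha₁ adj.counit)).symm

instance : (MM adj).IsLeftAdjoint := Presheaf.isLeftAdjoint_of_preservesColimits.{0} (C := SimplexCategoryᵒᵖ) (MM adj)

/-- Left leg. -/
noncomputable def Minl : DD ⋙ tensorRight (Δ[1] : SSet.{0}) ⟶ MM adj := pushout.inl alpha₁ adj.counit
/-- Right leg. -/
noncomputable def Minr : 𝟭 SSet.{0} ⟶ MM adj := pushout.inr alpha₁ adj.counit
/-- Free end. -/
noncomputable def Mi : DD ⟶ MM adj := alpha₀ ≫ Minl adj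

/-- Left leg, component. -/
noncomputable def minl (X : SSet.{0}) : DD.obj X ⊗ Δ[1] ⟶ (MM adj).obj X := (Minl adj).app X
/-- Right leg, component. -/
noncomputable def minr (X : SSet.{0}) : X ⟶ (MM adj).obj X := (Minr adj).app X
/-- Counit component. -/
noncomputable def gg (X : SSet.{0}) : DD.obj X ⟶ X := adj.counit.app X

lemma Mpush (X : SSet.{0}) :
    IsPushout (ι₁ : DD.obj X ⟶ DD.obj X ⊗ Δ[1]) (gg adj X) (minl adj X) (minr adj X) :=
  (IsPushout.of_hasPushout alpha₁ adj.counit).map ((evaluation _ _).obj X)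

lemma Mi_app (X : SSet.{0}) : (Mi adj).app X = ι₀ ≫ minl adj X := rfl

lemma minl_nat {X Y : SSet.{0}} (f : X ⟶ Y) :
    DD.map f ▷ Δ[1] ≫ minl adj Y = minl adj X ≫ (MM adj).map f := (Minl adj).naturality f

lemma minr_nat {X Y : SSet.{0}} (f : X ⟶ Y) :
    f ≫ minr adj Y = minr adj X ≫ (MM adj).map f := (Minr adj).naturality f

lemma gg_nat {X Y : SSet.{0}} (f : X ⟶ Y) :
    DD.map f ≫ gg adj Y = gg adj X ≫ f := adj.counit.naturality f

instance {X Y : SSet.{0}} (f : X ⟶ Y) [Mono f] : Mono (DD.map f) := 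
  mono_df (SemiSimplexCat.ι.op.lanAdjunction (Type)) f

lemma lemA {A X E B : SSet.{0}} (f : A ⟶ X) [Mono f] (p : E ⟶ B)
    (hp : (MorphismProperty.monomorphisms SSet.{0}).rlp p) : Ext (Mi adj) f p := by
  intro u c b w1 w2 w3
  have sq : CommSq (minr adj A ≫ c) f p (minr adj X ≫ b) := ⟨by
    rw [Category.assoc, w3, ← Category.assoc, ← minr_nat, Category.assoc]⟩
  have := hp f (.infer_property f)
  have hk1 : f ≫ sq.lift = minr adj A ≫ c := sq.fac_left
  have hk2 : sq.lift ≫ p = minr adj X ≫ b := sq.fac_right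
  generalize sq.lift = k at hk1 hk2
  rw [Mi_app, Category.assoc] at w1 w2
  obtain ⟨h, h1, h2, h3, h4⟩ := htpy_lift_mono (DD.map f) p hp u (gg adj X ≫ k) (minl adj A ≫ c)
    (minl adj X ≫ b) w1.symm
    (by rw [← Category.assoc, gg_nat, Category.assoc, hk1, ← Category.assoc, ← Category.assoc,
      (Mpush adj A).w]) w2
    (by rw [Category.assoc, hk2, ← Category.assoc, ← Category.assoc, (Mpush adj X).w])
    (by rw [Category.assoc, w3, ← Category.assoc, ← Category.assoc, minl_nat])
  refine ⟨(Mpush adj X).desc h k h2, ?_, ?_, ?_⟩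
  · rw [Mi_app, Category.assoc, (Mpush adj X).inl_desc, h1]
  · apply (Mpush adj A).hom_ext
    · rw [← Category.assoc, ← minl_nat, Category.assoc, (Mpush adj X).inl_desc, h3]
    · rw [← Category.assoc, ← minr_nat, Category.assoc, (Mpush adj X).inr_desc, hk1]
  · apply (Mpush adj X).hom_ext
    · rw [(Mpush adj X).inl_desc_assoc, h4]
    · rw [(Mpush adj X).inr_desc_assoc, hk2]

lemma leib_mono {A X : SSet.{0}} (f : A ⟶ X) [Mono f] : Mono (leib (Mi adj) f) :=
  mono_of_llp _ fun _ _ p hp => (ext_iff_leib (Mi adj) f p).1 (lemA adj f p hp)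

lemma ext_iff_init {A X E B : SSet.{0}} (hA : IsInitial A) (f : A ⟶ X)
    (p : E ⟶ B) : Ext (Mi adj) f p ↔ HasLiftingProperty ((Mi adj).app X) p := 
  ext_iff_initial (Mi adj) (Adjunction.ofIsLeftAdjoint DD) (Adjunction.ofIsLeftAdjoint (MM adj))
    hA f p

lemma ext_iff' {E B : SSet.{0}} (p : E ⟶ B) :
    ∃ (Q R : SSet.{0}) (q : Q ⟶ R), ∀ {A X : SSet.{0}} (f : A ⟶ X),
      Ext (Mi adj) f p ↔ HasLiftingProperty f q :=
  ext_iff (Mi adj) (Adjunction.ofIsLeftAdjoint DD) (Adjunction.ofIsLeftAdjoint (MM adj)) p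

/-- The initial object. -/
noncomputable def isInitBot (X : SSet.{0}) : IsInitial ((⊥ : X.Subcomplex) : SSet.{0}) := by
  exact Subcomplex.isInitialBot

instance Mi_mono (X : SSet.{0}) : Mono ((Mi adj).app X) :=
  mono_of_llp _ fun _ _ p hp =>
    (ext_iff_init adj (isInitBot X) (Subcomplex.ι ⊥) p).1 (lemA adj _ p hp)

/-- Projection to the interval. -/
noncomputable def Mproj (X : SSet.{0}) : (MM adj).obj X ⟶ Δ[1] :=
  (Mpush adj X).desc (snd _ _) (SSet.const (stdSimplex.obj₀Equiv.{0}.symm 1)) rfl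

lemma base (n : ℕ) : anodyneExtensions ((Mi adj).app Δ[n]) := by
  have hr : anodyneExtensions (minr adj Δ[n]) :=
    MorphismProperty.of_isPushout (Mpush adj _).flip (ι₁_anodyne _)
  have h1 := MorphismProperty.comp_mem _ _ _ (lastPt_anodyne n) hr
  let e : (Δ[1] : SSet.{0}) ⟶ (MM adj).obj Δ[n] :=
    lift (stdSimplex.isTerminalObj₀.from _ ≫ dPt adj n) (𝟙 _) ≫ minl adj _
  have e1 : lastPt n ≫ minr adj Δ[n] = vtx 1 ≫ e := by
    have h : dPt adj n ≫ ι₁ = vtx 1 ≫ lift (stdSimplex.isTerminalObj₀.from _ ≫ dPt adj n) (𝟙 _) := by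
      apply CartesianMonoidalCategory.hom_ext
      · have : vtx 1 ≫ stdSimplex.isTerminalObj₀.from _ = 𝟙 _ := stdSimplex.isTerminalObj₀.hom_ext _ _
        simp only [Category.assoc, lift_fst, reassoc_of% this]
        rfl
      · simp only [Category.assoc, lift_snd]
        rfl
    rw [← dPt_counit adj n, Category.assoc]
    erw [← (Mpush adj Δ[n]).w]
    rw [← Category.assoc, h, Category.assoc]
  have e0 : dPt adj n ≫ (Mi adj).app Δ[n] = vtx 0 ≫ e := by
    have h : dPt adj n ≫ ι₀ = vtx 0 ≫ lift (stdSimplex.isTerminalObj₀.from _ ≫ dPt adj n) (𝟙 _) := by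
      apply CartesianMonoidalCategory.hom_ext
      · have : vtx 0 ≫ stdSimplex.isTerminalObj₀.from _ = 𝟙 _ := stdSimplex.isTerminalObj₀.hom_ext _ _
        simp only [Category.assoc, lift_fst, reassoc_of% this]
        rfl
      · simp only [Category.assoc, lift_snd]
        rfl
    rw [Mi_app, ← Category.assoc]
    erw [h]
    rw [Category.assoc]
  have he : e ≫ Mproj adj _ = 𝟙 _ := by
    have h : minl adj Δ[n] ≫ Mproj adj _ = snd _ _ := (Mpush adj Δ[n]).inl_desc _ _ _
    simp only [e, Category.assoc]
    refine (congrArg (fun z => lift _ _ ≫ z) h).trans (lift_snd _ _)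
  have : Mono e := mono_of_mono_fac he
  have h2 : anodyneExtensions e := anodyne_cancel (vtx 1) e (vtx_anodyne 1) (e1 ▸ h1)
  have h3 := MorphismProperty.comp_mem _ _ _ (vtx_anodyne 0) h2
  exact anodyne_cancel (dPt adj n) _ (dPt_anodyne adj n) (e0 ▸ h3)

lemma ext_boundary (n : ℕ) : ∀ {E B : SSet.{0}} (p : E ⟶ B) [Fibration p],
    Ext (Mi adj) (∂Δ[n] : (Δ[n] : SSet.{0}).Subcomplex).ι p := by
  induction n using Nat.strong_induction_on with
  | _ n ih =>
  have hb : anodyneExtensions ((Mi adj).app (∂Δ[n] : (Δ[n] : SSet.{0}).Subcomplex)) := by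
    intro E B p hp
    rw [← HomotopicalAlgebra.fibration_iff] at hp
    rw [← ext_iff_init adj (isInitBot _) (Subcomplex.ι ⊥)]
    obtain ⟨Q, R, q, hq⟩ := ext_iff' adj p
    rw [hq]
    let I' : MorphismProperty SSet.{0} :=
      .ofHoms (fun m : Fin n => (∂Δ[m.1] : (Δ[m.1] : SSet.{0}).Subcomplex).ι)
    refine MorphismProperty.transfiniteCompositionsOfShape_pushouts_coproducts_le_llp_rlp.{0} I' ℕ _
        ⟨(relativeCellComplex _).transfiniteCompositionOfShape' (fun c ↦ ?_)⟩ q ?_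
    · have : c.j < n := by
        exact dim_lt_of_nonDegenerate _ ⟨c.k.simplex, c.k.nonDegenerate⟩ n
      exact ⟨(⟨c.j, this⟩ : Fin n)⟩
    · rintro _ _ _ ⟨m⟩
      exact (hq _).1 (ih m.1 m.2 p)
  intro E B p _
  rw [ext_iff_leib]
  have := leib_mono adj (∂Δ[n] : (Δ[n] : SSet.{0}).Subcomplex).ι
  have h1 : anodyneExtensions (pushout.inl (DD.map (∂Δ[n] : (Δ[n] : SSet.{0}).Subcomplex).ι)
      ((Mi adj).app _)) :=
    MorphismProperty.of_isPushout (IsPushout.of_hasPushout _ _) hb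
  refine anodyne_cancel _ (leib (Mi adj) (∂Δ[n] : (Δ[n] : SSet.{0}).Subcomplex).ι) h1 ?_ p
    (by rwa [← HomotopicalAlgebra.fibration_iff])
  rw [inl_leib]
  exact base adj n

lemma Mi_anodyne (X : SSet.{0}) : anodyneExtensions ((Mi adj).app X) := by
  intro E B p hp
  rw [← HomotopicalAlgebra.fibration_iff] at hp
  rw [← ext_iff_init adj (isInitBot _) (Subcomplex.ι ⊥)]
  obtain ⟨Q, R, q, hq⟩ := ext_iff' adj p
  rw [hq]
  have : (MorphismProperty.monomorphisms SSet.{0}).rlp q := by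
    rw [rlp_monomorphisms]
    rintro _ _ _ ⟨n⟩
    exact (hq _).1 (ext_boundary adj n p)
  exact this _ (.infer_property _)

lemma counit_he (X : SSet.{0}) : IsHomotopyEquivalence (SSet.toTop.map (adj.counit.app X)).hom := by
  let r : (MM adj).obj X ⟶ X := (Mpush adj X).desc (fst _ _ ≫ gg adj X) (𝟙 X) (by
    rw [Category.comp_id, ← Category.assoc]
    exact Category.id_comp _)
  have h1 : minr adj X ≫ r = 𝟙 _ := (Mpush adj X).inr_desc _ _ _
  have h2 : (Mi adj).app X ≫ r = adj.counit.app X := by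
    rw [Mi_app, Category.assoc, (Mpush adj X).inl_desc, ← Category.assoc]
    exact Category.id_comp _
  have hr : anodyneExtensions (minr adj X) :=
    MorphismProperty.of_isPushout (Mpush adj _).flip (ι₁_anodyne _)
  have hr' : IsHomotopyEquivalence (SSet.toTop.map r).hom := by
    refine IsHomotopyEquivalence.congr_left (anodyne_toTop _ hr) ?_
    rw [← TopCat.hom_comp, ← Functor.map_comp, h1, CategoryTheory.Functor.map_id]
    exact isHomotopyEquivalence_id
  have := (anodyne_toTop _ (Mi_anodyne adj X)).comp hr'
  rwa [← TopCat.hom_comp, ← Functor.map_comp, h2] at this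

end SSetAux

end PartH

/-- For every simplicial set `X`, the counit `g : 𝔡(𝔣(X)) ⟶ X` of the adjunction `𝔡 ⊣ 𝔣`
induces a homotopy equivalence `|g| : |𝔡(𝔣(X))| → |X|` of geometric realizations. -/
theorem counit_realization_homotopyEquiv (adj : SemiSSet.d ⊣ SemiSSet.f) (X : SSet.{0}) :
    IsHomotopyEquivalence (SSet.toTop.map (adj.counit.app X)).hom := by
  exact SSetAux.counit_he adj X
end
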